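/- Let d ≥ 3, and adopt the shell setup: Q_N ⊆ D ⊆ Z^d, 16 ≤ n < n+m ≤ N with m ≤ n/8, L the loop erasure of simple random walk from 0 stopped at its first exit from D, α the initial segment of L up to its first hit of ∂_i Q_n with endpoint x₀, β the segment of L from x₀ up to its first hit of ∂_i Q(x₀,m), and A the box Q(x₀ + (m/2)e₁, m/4) (suitably rotated if x₀ is not on the face H_n). Then there exists a constant c₁ = c₁(d) such that for every realization of α: E( H_A(β) | α ) ≤ c₁ m² and E( H_A(β)² | α ) ≤ c₁ m⁴, where H_A(β) is the number of points of β lying in A. -/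

import Mathlib

open MeasureTheory
open scoped ENNReal Classical

namespace USFPaper

/-- Vertices of the nearest-neighbour integer lattice `ℤ^d`. -/
abbrev V (d : ℕ) := Fin d → ℤ

variable {d : ℕ}

/-- Nearest-neighbour adjacency in `ℤ^d`. -/
def adj (x y : V d) : Prop := (∑ i, |x i - y i|) = 1

/-- The cube `Q(x,r) = { y : ‖x - y‖_∞ ≤ r }`. -/
def cube (x : V d) (r : ℕ) : Set (V d) := { y | ∀ i, |y i - x i| ≤ (r : ℤ) }

/-- Inner boundary `∂ᵢA` of a set `A`. -/
def innerBdry (A : Set (V d)) : Set (V d) := { x | x ∈ A ∧ ∃ y, adj x y ∧ y ∉ A }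

/-- Euclidean distance on `ℤ^d`. -/
noncomputable def eudist (x y : V d) : ℝ := Real.sqrt (∑ i, ((x i : ℝ) - (y i : ℝ)) ^ 2)

/-- The `k`-th coordinate unit vector. -/
def unitVec (k : ℕ) : V d := fun i => if (i : ℕ) = k then 1 else 0

/-- `μ` is the law of simple random walk on `ℤ^d` started at `x`, as a probability
measure on path space: every nearest-neighbour cylinder of length `n` starting at `x`
has probability `(2d)⁻ⁿ`. -/
def IsSRWLaw (μ : Measure (ℕ → V d)) (x : V d) : Prop :=
  IsProbabilityMeasure μ ∧
  ∀ (n : ℕ) (γ : ℕ → V d), γ 0 = x → (∀ i < n, adj (γ i) (γ (i + 1))) →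
    μ { ω | ∀ i ≤ n, ω i = γ i } = (2 * (d : ℝ≥0∞))⁻¹ ^ n

/-- First exit time `τ_A` from `A`, valued in `ℕ∞` (`⊤` if the path never leaves `A`). -/
noncomputable def exitTimeE (A : Set (V d)) (ω : ℕ → V d) : ENat :=
  if h : ∃ j, ω j ∉ A then (Nat.find h : ENat) else ⊤

/-- First hitting time `T_A` of `A`, valued in `ℕ∞`. -/
noncomputable def hitTimeE (A : Set (V d)) (ω : ℕ → V d) : ENat :=
  if h : ∃ j, ω j ∈ A then (Nat.find h : ENat) else ⊤

/-- First positive hitting time `T⁺_A` of `A`, valued in `ℕ∞`. -/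
noncomputable def hitTimePosE (A : Set (V d)) (ω : ℕ → V d) : ENat :=
  if h : ∃ j, 1 ≤ j ∧ ω j ∈ A then (Nat.find h : ENat) else ⊤

/-- First exit time from `A` as a natural number (junk value `0` if the path never exits). -/
noncomputable def exitTime (A : Set (V d)) (ω : ℕ → V d) : ℕ := (exitTimeE A ω).toNat

/-- Index of the first hit of `A` (junk value `0` if `A` is never hit). -/
noncomputable def hitIdx (A : Set (V d)) (γ : ℕ → V d) : ℕ := (hitTimeE A γ).toNat

/-- First index `≥ t` at which the path lies in `A` (junk value `t`). -/
noncomputable def hitIdxFrom (A : Set (V d)) (t : ℕ) (γ : ℕ → V d) : ℕ :=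
  if h : ∃ j, t ≤ j ∧ γ j ∈ A then Nat.find h else t

/-- The path frozen at its first exit from `D`. -/
noncomputable def stopAt (D : Set (V d)) (ω : ℕ → V d) : ℕ → V d :=
  fun j => if (j : ENat) ≤ exitTimeE D ω then ω j else ω (exitTime D ω)

/-- Time of the last visit of the path to the point `ω t`, at or after time `t`
(junk value if there are infinitely many such visits). -/
noncomputable def lastVisit (ω : ℕ → V d) (t : ℕ) : ℕ := sSup { j | t ≤ j ∧ ω j = ω t }

/-- The times of the chronological loop erasure (last-exit decomposition). -/
noncomputable def leTime (ω : ℕ → V d) : ℕ → ℕ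
  | 0 => lastVisit ω 0
  | k + 1 => lastVisit ω (leTime ω k + 1)

/-- Chronological loop erasure of an (infinite, transient) path. -/
noncomputable def infLoopErase (ω : ℕ → V d) : ℕ → V d := fun k => ω (leTime ω k)

/-- The loop erasure `L` of the walk stopped at its first exit from `D`. -/
noncomputable def lerw (D : Set (V d)) (ω : ℕ → V d) : ℕ → V d := infLoopErase (stopAt D ω)

/-- The event `T_A > τ_D`: the walk does not visit `A` at any time up to (and
including) its first exit from `D`; if it never exits `D`, it never visits `A`. -/
def avoidBeforeExit (D A : Set (V d)) (ω : ℕ → V d) : Prop :=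
  ∀ j : ℕ, (j : ENat) ≤ exitTimeE D ω → ω j ∉ A

/-- The event `T⁺_A > τ_D` (visits of `A` at positive times only). -/
def avoidBeforeExitPos (D A : Set (V d)) (ω : ℕ → V d) : Prop :=
  ∀ j : ℕ, 1 ≤ j → (j : ENat) ≤ exitTimeE D ω → ω j ∉ A

/-- The right-hand face (in the first coordinate direction) of the cube `Q(x₀,m)`. -/
def rightFace (x₀ : V d) (m : ℕ) : Set (V d) :=
  { y | y ∈ cube x₀ m ∧ ∀ i : Fin d, (i : ℕ) = 0 → y i = x₀ i + (m : ℤ) }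


/-- The unit vector pointing towards the face of the cube `Q(0,n)` on which `x₀`
lies (the first coordinate realising `|x₀ i| = n`; junk value `0` if there is none). -/
noncomputable def faceDir (x₀ : V d) (n : ℕ) : V d :=
  if h : ∃ i : Fin d, |x₀ i| = (n : ℤ) then
    fun j => if j = Classical.choose h then (if 0 ≤ x₀ (Classical.choose h) then 1 else -1) else 0
  else 0

/-- The point `x₁ = x₀ + (m/2) e₁` (with `e₁` replaced by the unit vector pointing
towards the face of `Q(0,n)` containing `x₀`). -/
noncomputable def x1pt (x₀ : V d) (n m : ℕ) : V d := x₀ + ((m / 2 : ℕ) : ℤ) • faceDir x₀ n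

/-- The box `A = Q(x₁, m/4)`. -/
noncomputable def boxA (x₀ : V d) (n m : ℕ) : Set (V d) := cube (x1pt x₀ n m) (m / 4)

/-- A second unit direction, orthogonal to `faceDir x₀ n`, reflected according to the
sign of the corresponding coordinate of `x₀` (junk value `0` in degenerate cases). -/
noncomputable def sideDir (x₀ : V d) (n : ℕ) : V d :=
  if h : ∃ i : Fin d, |x₀ i| = (n : ℤ) then
    (if h2 : ∃ j : Fin d, j ≠ Classical.choose h then
      fun t => if t = Classical.choose h2 then (if x₀ (Classical.choose h2) ≤ 0 then 1 else -1) else 0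
    else 0)
  else 0

/-- The point `x₂ = x₁ + m e₂` (suitably rotated/reflected). -/
noncomputable def x2pt (x₀ : V d) (n m : ℕ) : V d := x1pt x₀ n m + (m : ℤ) • sideDir x₀ n

/-- `α`: the initial segment of the loop erasure `L = lerw D ω` up to its first hit
of `∂ᵢ Q(0,n)`, as a list. -/
noncomputable def alphaList (D : Set (V d)) (n : ℕ) (ω : ℕ → V d) : List (V d) :=
  (List.range (hitIdx (innerBdry (cube 0 n)) (lerw D ω) + 1)).map (lerw D ω)

/-- The endpoint `x₀` of a finite path (junk value `0` for the empty path). -/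
def endPt (a : List (V d)) : V d := (a.getLast?).getD 0

/-- `β`: the segment of the loop erasure `L = lerw D ω` from its first hit `x₀` of
`∂ᵢ Q(0,n)` up to its first subsequent hit of `∂ᵢ Q(x₀,m)`, as a list. -/
noncomputable def betaList (D : Set (V d)) (n m : ℕ) (ω : ℕ → V d) : List (V d) :=
  let γ := lerw D ω
  let k₁ := hitIdx (innerBdry (cube 0 n)) γ
  let k₂ := hitIdxFrom (innerBdry (cube (γ k₁) m)) k₁ γ
  (List.range (k₂ - k₁ + 1)).map fun i => γ (k₁ + i)

/-- `H_A(γ)`: the number of points of the path `γ` lying in the set `A`. -/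
noncomputable def hitCount (A : Set (V d)) (l : List (V d)) : ℕ :=
  (l.map fun v => if v ∈ A then 1 else 0).sum

/-- coordinate vector -/
def ee (i : Fin d) : V d := Pi.single i 1

/-- unnormalised Laplacian -/
noncomputable def Lap (f : V d → ℝ) (x : V d) : ℝ :=
  ∑ i, (f (x + ee i) + f (x - ee i) - 2 * f x)

/-- squared norm -/
noncomputable def nsq (x : V d) : ℝ := ∑ i, (x i : ℝ) ^ 2

lemma ee_same (i : Fin d) : (ee i : V d) i = 1 := by simp [ee]
lemma ee_ne {i j : Fin d} (h : j ≠ i) : (ee i : V d) j = 0 := by simp [ee, h]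

lemma nsq_split (x : V d) (i : Fin d) :
    nsq x = (x i : ℝ) ^ 2 + ∑ j ∈ Finset.univ.erase i, (x j : ℝ) ^ 2 := by
  unfold nsq
  rw [Finset.add_sum_erase _ (fun j => ((x j : ℝ)) ^ 2) (Finset.mem_univ i)]

lemma nsq_add (x : V d) (i : Fin d) : nsq (x + ee i) = nsq x + 2 * x i + 1 := by
  rw [nsq_split _ i, nsq_split x i]
  have : ∑ j ∈ Finset.univ.erase i, (((x + ee i) j : ℤ) : ℝ) ^ 2
      = ∑ j ∈ Finset.univ.erase i, (x j : ℝ) ^ 2 := by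
    apply Finset.sum_congr rfl
    intro j hj
    rw [Pi.add_apply, ee_ne (Finset.ne_of_mem_erase hj)]; simp
  rw [this, Pi.add_apply, ee_same]; push_cast; ring

lemma nsq_sub (x : V d) (i : Fin d) : nsq (x - ee i) = nsq x - 2 * x i + 1 := by
  have := nsq_add (x - ee i) i
  rw [sub_add_cancel, Pi.sub_apply, ee_same] at this
  push_cast at this
  linarith

lemma nsq_nonneg (x : V d) : 0 ≤ nsq x := Finset.sum_nonneg fun _ _ => sq_nonneg _

lemma sq_le_nsq (x : V d) (i : Fin d) : (x i : ℝ) ^ 2 ≤ nsq x := by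
  rw [nsq_split x i]
  have : 0 ≤ ∑ j ∈ Finset.univ.erase i, (x j : ℝ) ^ 2 := Finset.sum_nonneg fun _ _ => sq_nonneg _
  linarith

lemma cube_finite (x : V d) (r : ℕ) : (cube x r).Finite := by
  apply (Set.finite_Icc (fun i => x i - (r : ℤ)) (fun i => x i + (r : ℤ))).subset
  intro y hy
  rw [Set.mem_Icc]
  constructor <;> intro i <;> have := abs_le.1 (hy i) <;> dsimp only <;> omega

lemma maxP (hd : 0 < d) (B : Set (V d)) (hB : B.Finite) (f : V d → ℝ)
    (hsub : ∀ x ∈ B, 0 ≤ Lap f x)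
    (hbd : ∀ x ∈ B, 0 < f x → ∀ i, (x + ee i ∉ B → f (x + ee i) ≤ 0) ∧
      (x - ee i ∉ B → f (x - ee i) ≤ 0)) : ∀ x ∈ B, f x ≤ 0 := by
  by_contra! hcon
  obtain ⟨x₀, hx₀, hpos₀⟩ := hcon
  obtain ⟨x₁, hx₁, hmax⟩ := Set.exists_max_image B f hB ⟨x₀, hx₀⟩
  have hM : 0 < f x₁ := lt_of_lt_of_le hpos₀ (hmax _ hx₀)
  let i₀ : Fin d := ⟨0, hd⟩
  obtain ⟨x, ⟨hxB, hxM⟩, hmax2⟩ := Set.exists_max_image {x | x ∈ B ∧ f x = f x₁} (fun x => x i₀)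
    (hB.subset fun x hx => hx.1) ⟨x₁, hx₁, rfl⟩
  have hx0 : 0 < f x := by rw [hxM]; exact hM
  have h1 : ∀ i, f (x + ee i) ≤ f x := by
    intro i
    by_cases h : x + ee i ∈ B
    · rw [hxM]; exact hmax _ h
    · exact ((hbd x hxB hx0 i).1 h).trans hx0.le
  have h2 : ∀ i, f (x - ee i) ≤ f x := by
    intro i
    by_cases h : x - ee i ∈ B
    · rw [hxM]; exact hmax _ h
    · exact ((hbd x hxB hx0 i).2 h).trans hx0.le
  have h3 : ∑ i, (f (x + ee i) + f (x - ee i) - 2 * f x) = 0 := by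
    apply le_antisymm
    · apply Finset.sum_nonpos; intro i _; linarith [h1 i, h2 i]
    · exact hsub x hxB
  have h4 := (Finset.sum_eq_zero_iff_of_nonpos
    (fun i _ => by linarith [h1 i, h2 i])).1 h3 i₀ (Finset.mem_univ _)
  have h5 : f (x + ee i₀) = f x := le_antisymm (h1 _) (by linarith [h2 i₀])
  have h6 : x + ee i₀ ∈ B := by
    by_contra h
    linarith [(hbd x hxB hx0 i₀).1 h]
  have h7 := hmax2 (x + ee i₀) ⟨h6, by rw [h5, hxM]⟩
  simp only [Pi.add_apply, ee_same] at h7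
  omega

/-- reflection -/
noncomputable def refl (i : Fin d) (x : V d) : V d := Function.update x i (1 - x i)

lemma refl_same (i : Fin d) (x : V d) : refl i x i = 1 - x i := by simp [refl]
lemma refl_ne {i j : Fin d} (h : j ≠ i) (x : V d) : refl i x j = x j := by simp [refl, h]

lemma refl_add (i j : Fin d) (x : V d) :
    refl i (x + ee j) = if j = i then refl i x - ee j else refl i x + ee j := by
  funext k
  by_cases hji : j = i
  · subst hji
    by_cases hk : k = j
    · subst hk; simp [refl_same, ee_same]
    · simp [refl_ne hk, ee_ne hk]
  · by_cases hk : k = i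
    · subst hk; simp [refl_same, ee_ne (Ne.symm hji), hji]
    · simp [refl_ne hk, hji]

lemma refl_sub (i j : Fin d) (x : V d) :
    refl i (x - ee j) = if j = i then refl i x + ee j else refl i x - ee j := by
  funext k
  by_cases hji : j = i
  · subst hji
    by_cases hk : k = j
    · subst hk; simp [refl_same, ee_same]; ring
    · simp [refl_ne hk, ee_ne hk]
  · by_cases hk : k = i
    · subst hk; simp [refl_same, ee_ne (Ne.symm hji), hji]
    · simp [refl_ne hk, hji]

lemma Lap_refl (i : Fin d) (h : V d → ℝ) (x : V d) :
    Lap (fun y => h (refl i y)) x = Lap h (refl i x) := by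
  unfold Lap
  apply Finset.sum_congr rfl
  intro j _
  simp only [refl_add, refl_sub]
  split_ifs <;> ring

/-- numerator of the barrier -/
noncomputable def bar (i : Fin d) (r : ℝ) (x : V d) : ℝ :=
  nsq x - (x i : ℝ) ^ 2 - ((d : ℝ) - 1) * ((x i : ℝ) - 1 / 2) ^ 2
    + 2 * d * r * ((x i : ℝ) - 1 / 2) + ((d : ℝ) - 1) / 4

lemma Lap_bar (i : Fin d) (r : ℝ) (x : V d) : Lap (bar i r) x = 0 := by
  unfold Lap
  have : ∀ j, bar i r (x + ee j) + bar i r (x - ee j) - 2 * bar i r x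
      = 2 + (if j = i then -(2 * (d : ℝ)) else 0) := by
    intro j
    unfold bar
    rw [nsq_add, nsq_sub]
    by_cases hj : j = i
    · subst hj
      simp only [Pi.add_apply, Pi.sub_apply, ee_same, if_true]; push_cast; ring
    · simp only [Pi.add_apply, Pi.sub_apply, ee_ne (Ne.symm hj), hj, if_false]; push_cast; ring
  simp only [this, Finset.sum_add_distrib, Finset.sum_ite_eq', Finset.mem_univ, if_true]
  simp; ring

lemma mem_cube0 {x : V d} {r : ℕ} : x ∈ cube (0 : V d) r ↔ ∀ j, -(r : ℤ) ≤ x j ∧ x j ≤ r := by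
  simp [cube, abs_le]

lemma grad0 (i : Fin d) (r : ℕ) (hr : 1 ≤ r) (h : V d → ℝ) (M : ℝ)
    (harm : ∀ x ∈ cube (0 : V d) r, Lap h x = 0)
    (bd : ∀ x ∈ cube (0 : V d) (r + 1), 0 ≤ h x ∧ h x ≤ M) :
    h (ee i) - h 0 ≤ M * d / r := by
  have hd : 0 < d := i.pos
  have hd1 : (1 : ℝ) ≤ d := by exact_mod_cast hd
  have hr1 : (1 : ℝ) ≤ r := by exact_mod_cast hr
  have hM : 0 ≤ M := by
    have := bd 0 (by rw [mem_cube0]; intro j; simp; omega)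
    linarith
  let B : Set (V d) := {x | x ∈ cube (0 : V d) r ∧ 1 ≤ x i}
  have hB : B.Finite := (cube_finite 0 r).subset fun x hx => hx.1
  let F : V d → ℝ := fun x => h x - h (refl i x) - M / r ^ 2 * bar i r x
  have hLapF : ∀ x, Lap F x = Lap h x - Lap h (refl i x) - M / r ^ 2 * Lap (bar i r) x := by
    intro x
    rw [← Lap_refl]
    unfold Lap
    rw [Finset.mul_sum, ← Finset.sum_sub_distrib, ← Finset.sum_sub_distrib]
    apply Finset.sum_congr rfl
    intro j _
    simp only [F]; ring
  -- value on the outer boundary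
  have outer : ∀ y : V d, y ∈ cube (0 : V d) (r + 1) → 1 ≤ y i → (∃ j, (r : ℤ) + 1 ≤ |y j|) →
      F y ≤ 0 := by
    intro y hy hyi ⟨j, hj⟩
    rw [mem_cube0] at hy
    have hy' : refl i y ∈ cube (0 : V d) (r + 1) := by
      rw [mem_cube0]; intro k
      by_cases hk : k = i
      · subst hk; rw [refl_same]; have := hy k; push_cast at this ⊢; omega
      · rw [refl_ne hk]; exact hy k
    have h1 := (bd y (mem_cube0.2 hy)).2
    have h2 := (bd _ hy').1
    have hyi1 : (1 : ℝ) ≤ y i := by exact_mod_cast hyi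
    have hyi2 : (y i : ℝ) ≤ r + 1 := by exact_mod_cast (hy i).2
    have hbar : (r : ℝ) ^ 2 ≤ bar i r y := by
      unfold bar
      by_cases hji : j = i
      · subst hji
        have e1 : (r : ℝ) + 1 ≤ y j := by
          rw [abs_of_pos (by omega)] at hj; exact_mod_cast hj
        have e2 : (y j : ℝ) = r + 1 := le_antisymm hyi2 e1
        have := sq_le_nsq y j
        rw [e2] at this ⊢
        nlinarith [mul_nonneg (sub_nonneg.2 hd1) (sub_nonneg.2 hr1), mul_nonneg (mul_nonneg (sub_nonneg.2 hd1) (sub_nonneg.2 hr1)) (sub_nonneg.2 hr1)]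
      · have e1 : ((r : ℝ) + 1) ^ 2 ≤ (y j : ℝ) ^ 2 := by
          rw [← sq_abs (y j : ℝ)]
          have : (r : ℝ) + 1 ≤ |(y j : ℝ)| := by exact_mod_cast hj
          gcongr
        have e2 : (y j : ℝ) ^ 2 ≤ nsq y - (y i : ℝ) ^ 2 := by
          rw [nsq_split y i]
          have := Finset.single_le_sum (f := fun k => (y k : ℝ) ^ 2) (fun _ _ => sq_nonneg _)
            (Finset.mem_erase.2 ⟨hji, Finset.mem_univ j⟩)
          linarith
        have e3 : 0 ≤ ((y i : ℝ) - 1 / 2) * (2 * d * r - ((d : ℝ) - 1) * ((y i : ℝ) - 1 / 2)) := by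
          apply mul_nonneg (by linarith)
          nlinarith [mul_nonneg (sub_nonneg.2 hd1) (sub_nonneg.2 hyi2), mul_nonneg (sub_nonneg.2 hd1) (sub_nonneg.2 hr1)]
        nlinarith
    have : M ≤ M / r ^ 2 * bar i r y := by
      rw [div_mul_eq_mul_div, le_div_iff₀ (by positivity)]
      exact mul_le_mul_of_nonneg_left hbar hM
    simp only [F]; linarith
  have key : ∀ x ∈ B, F x ≤ 0 := by
    apply maxP hd B hB F
    · intro x hx
      have h2 : refl i x ∈ cube (0 : V d) r := by
        have := hx.1
        rw [mem_cube0] at this ⊢; intro k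
        by_cases hk : k = i
        · subst hk; rw [refl_same]; have := this k; have := hx.2; omega
        · rw [refl_ne hk]; exact this k
      rw [hLapF, harm x hx.1, harm _ h2, Lap_bar]; simp
    · intro x hx hpos j
      have hxc := mem_cube0.1 hx.1
      have hxi := hx.2
      constructor
      · intro hn
        apply outer
        · rw [mem_cube0]; intro k
          by_cases hk : k = j
          · subst hk; simp only [Pi.add_apply, ee_same]; have := hxc k; push_cast; omega
          · simp only [Pi.add_apply, ee_ne hk]; have := hxc k; push_cast; omega
        · by_cases hk : i = j
          · subst hk; simp only [Pi.add_apply, ee_same]; omega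
          · simp only [Pi.add_apply, ee_ne hk]; omega
        · by_contra! hno
          apply hn
          refine ⟨mem_cube0.2 fun k => ?_, ?_⟩
          · have := abs_lt.1 (hno k); omega
          · by_cases hk : i = j
            · subst hk; simp only [Pi.add_apply, ee_same]; omega
            · simp only [Pi.add_apply, ee_ne hk]; omega
      · intro hn
        by_cases hji : j = i ∧ x i = 1
        · obtain ⟨rfl, hx1⟩ := hji
          have e1 : x - ee j = refl j x := by
            funext k
            by_cases hk : k = j
            · subst hk; simp [refl_same, ee_same, hx1]
            · simp [refl_ne hk, ee_ne hk]
          have e2 : refl j (x - ee j) = x := by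
            rw [refl_sub, if_pos rfl, ← e1]; simp
          have e3 : 0 ≤ bar j r x + bar j r (x - ee j) := by
            unfold bar
            rw [nsq_sub]
            have := sq_le_nsq x j
            simp only [Pi.sub_apply, ee_same, hx1] at this ⊢
            push_cast at this ⊢
            nlinarith
          have e4 : 0 ≤ M / r ^ 2 * (bar j r x + bar j r (x - ee j)) := by positivity
          have : F (x - ee j) = - F x - M / r ^ 2 * (bar j r x + bar j r (x - ee j)) := by
            simp only [F, e2]; rw [← e1]; ring
          rw [this]; linarith
        · have hge : 1 ≤ (x - ee j) i := by
            by_cases hk : i = j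
            · subst hk; simp only [Pi.sub_apply, ee_same]; omega
            · simp only [Pi.sub_apply, ee_ne hk]; omega
          apply outer _ _ hge
          · by_contra! hno
            apply hn
            refine ⟨mem_cube0.2 fun k => ?_, hge⟩
            have := abs_lt.1 (hno k); omega
          · rw [mem_cube0]; intro k
            by_cases hk : k = j
            · subst hk; simp only [Pi.sub_apply, ee_same]; have := hxc k; push_cast; omega
            · simp only [Pi.sub_apply, ee_ne hk]; have := hxc k; push_cast; omega
  have hmem : (ee i : V d) ∈ B := by
    refine ⟨mem_cube0.2 fun k => ?_, by simp [ee_same]⟩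
    by_cases hk : k = i
    · subst hk; rw [ee_same]; omega
    · rw [ee_ne hk]; omega
  have := key _ hmem
  have e1 : refl i (ee i) = 0 := by
    funext k
    by_cases hk : k = i
    · subst hk; simp [refl_same, ee_same]
    · simp [refl_ne hk, ee_ne hk]
  have e2 : bar i r (ee i) = d * r := by
    unfold bar
    have : nsq (ee i : V d) = 1 := by
      have := nsq_add (0 : V d) i
      simpa [nsq] using this
    rw [this, ee_same]; push_cast; ring
  simp only [F, e1, e2] at this
  have e3 : M / (r : ℝ) ^ 2 * (d * r) = M * d / r := by field_simp
  linarith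

lemma Lap_shift (h : V d → ℝ) (w x : V d) : Lap (fun y => h (w + y)) x = Lap h (w + x) := by
  unfold Lap; simp only [add_assoc, add_sub_assoc]

lemma mem_cube_shift {w x : V d} {r : ℕ} : w + x ∈ cube w r ↔ x ∈ cube (0 : V d) r := by
  simp [cube]

lemma grad (i : Fin d) (w : V d) (r : ℕ) (hr : 1 ≤ r) (h : V d → ℝ) (M : ℝ)
    (harm : ∀ x ∈ cube w r, Lap h x = 0)
    (bd : ∀ x ∈ cube w (r + 1), 0 ≤ h x ∧ h x ≤ M) :
    |h (w + ee i) - h w| ≤ M * d / r := by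
  rw [abs_le]
  have h1 := grad0 i r hr (fun y => h (w + y)) M
    (fun x hx => by rw [Lap_shift]; exact harm _ (mem_cube_shift.2 hx))
    (fun x hx => bd _ (mem_cube_shift.2 hx))
  have h2 := grad0 i r hr (fun y => M - h (w + y)) M
    (fun x hx => by
      have : Lap (fun y => M - h (w + y)) x = - Lap (fun y => h (w + y)) x := by
        unfold Lap; rw [← Finset.sum_neg_distrib]; apply Finset.sum_congr rfl; intros; ring
      rw [this, Lap_shift, harm _ (mem_cube_shift.2 hx), neg_zero])
    (fun x hx => by have := bd _ (mem_cube_shift.2 hx); constructor <;> linarith)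
  simp only [add_zero] at h1 h2
  constructor <;> linarith

lemma box_induct (w : V d) (s : ℕ) (P : ℕ → V d → Prop) (h0 : P 0 w)
    (hs : ∀ k y i, y ∈ cube w s → y + ee i ∈ cube w s → P k y → P (k + 1) (y + ee i))
    (hs' : ∀ k y i, y ∈ cube w s → y - ee i ∈ cube w s → P k y → P (k + 1) (y - ee i)) :
    ∀ y ∈ cube w s, ∃ k ≤ d * s, P k y := by
  have key : ∀ k : ℕ, ∀ y ∈ cube w s, ∑ i, |y i - w i| = (k : ℤ) → P k y := by
    intro k
    induction k with
    | zero =>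
      intro y hy hk
      have : y = w := by
        funext i
        have := (Finset.sum_eq_zero_iff_of_nonneg (fun i _ => abs_nonneg (y i - w i))).1
          (by simpa using hk) i (Finset.mem_univ _)
        have := abs_eq_zero.1 this
        omega
      rw [this]; exact h0
    | succ k ih =>
      intro y hy hk
      have : ∃ i, y i - w i ≠ 0 := by
        by_contra! hno
        simp only [hno] at hk
        simp at hk
        omega
      obtain ⟨i, hi⟩ := this
      rcases lt_or_gt_of_ne hi with hlt | hgt
      · have hy' : y + ee i ∈ cube w s := by
          intro j
          by_cases hj : j = i
          · subst hj; have := abs_le.1 (hy j); rw [Pi.add_apply, ee_same, abs_le]; omega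
          · have := hy j; rw [Pi.add_apply, ee_ne hj]; simpa using this
        have e : y = (y + ee i) - ee i := by simp
        rw [e]
        apply hs' k _ i hy' (by simpa using hy)
        apply ih _ hy'
        rw [← Finset.add_sum_erase _ _ (Finset.mem_univ i)] at hk ⊢
        have : ∑ j ∈ Finset.univ.erase i, |(y + ee i) j - w j|
            = ∑ j ∈ Finset.univ.erase i, |y j - w j| := by
          apply Finset.sum_congr rfl
          intro j hj
          rw [Pi.add_apply, ee_ne (Finset.ne_of_mem_erase hj)]; simp
        rw [this, Pi.add_apply, ee_same]
        rw [abs_of_neg hlt] at hk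
        rw [abs_of_nonpos (by omega)]
        push_cast at hk; omega
      · have hy' : y - ee i ∈ cube w s := by
          intro j
          by_cases hj : j = i
          · subst hj; have := abs_le.1 (hy j); rw [Pi.sub_apply, ee_same, abs_le]; omega
          · have := hy j; rw [Pi.sub_apply, ee_ne hj]; simpa using this
        have e : y = (y - ee i) + ee i := by simp
        rw [e]
        apply hs k _ i hy' (by simpa using hy)
        apply ih _ hy'
        rw [← Finset.add_sum_erase _ _ (Finset.mem_univ i)] at hk ⊢
        have : ∑ j ∈ Finset.univ.erase i, |(y - ee i) j - w j|
            = ∑ j ∈ Finset.univ.erase i, |y j - w j| := by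
          apply Finset.sum_congr rfl
          intro j hj
          rw [Pi.sub_apply, ee_ne (Finset.ne_of_mem_erase hj)]; simp
        rw [this, Pi.sub_apply, ee_same]
        rw [abs_of_pos hgt] at hk
        rw [abs_of_nonneg (by omega)]
        push_cast at hk; omega
  intro y hy
  refine ⟨(∑ i, |y i - w i|).toNat, ?_, key _ y hy ?_⟩
  · have : ∑ i, |y i - w i| ≤ ∑ _i : Fin d, (s : ℤ) := Finset.sum_le_sum fun i _ => hy i
    simp at this
    rw [Int.toNat_le]; push_cast; exact this
  · rw [Int.toNat_of_nonneg (Finset.sum_nonneg fun i _ => abs_nonneg _)]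

/-- Lipschitz along the box. -/
lemma box_lip (w : V d) (s : ℕ) (f : V d → ℝ) (ε : ℝ) (hε : 0 ≤ ε)
    (hl : ∀ y i, y ∈ cube w s → |f (y + ee i) - f y| ≤ ε) :
    ∀ y ∈ cube w s, |f y - f w| ≤ d * s * ε := by
  intro y hy
  obtain ⟨k, hk, hP⟩ := box_induct w s (fun k y => |f y - f w| ≤ k * ε) (by simp)
    (by
      intro k y i hy _ h
      have := hl y i hy
      push_cast
      calc |f (y + ee i) - f w| ≤ |f (y + ee i) - f y| + |f y - f w| := abs_sub_le _ _ _
        _ ≤ _ := by linarith)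
    (by
      intro k y i hy hy' h
      have := hl _ i hy'
      simp only [sub_add_cancel] at this
      rw [abs_sub_comm] at this
      push_cast
      calc |f (y - ee i) - f w| ≤ |f (y - ee i) - f y| + |f y - f w| := abs_sub_le _ _ _
        _ ≤ _ := by linarith) y hy
  refine hP.trans ?_
  have : (k : ℝ) ≤ d * s := by exact_mod_cast hk
  gcongr

lemma crude (w : V d) (s : ℕ) (h : V d → ℝ) (h0 : ∀ x, 0 ≤ h x)
    (harm : ∀ x ∈ cube w s, Lap h x = 0) :
    ∀ y ∈ cube w s, h w ≤ (2 * d) ^ (d * s) * h y := by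
  have sum_eq : ∀ x ∈ cube w s, ∑ i, (h (x + ee i) + h (x - ee i)) = 2 * d * h x := by
    intro x hx
    have := harm x hx
    unfold Lap at this
    rw [Finset.sum_sub_distrib] at this
    simp at this
    linarith
  have step : ∀ x ∈ cube w s, ∀ i, h (x + ee i) ≤ 2 * d * h x ∧ h (x - ee i) ≤ 2 * d * h x := by
    intro x hx i
    have := Finset.single_le_sum (f := fun i => h (x + ee i) + h (x - ee i))
      (fun j _ => add_nonneg (h0 _) (h0 _)) (Finset.mem_univ i)
    rw [sum_eq x hx] at this
    constructor <;> linarith [h0 (x + ee i), h0 (x - ee i)]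
  intro y hy
  obtain ⟨k, hk, hP⟩ := box_induct w s (fun k y => h w ≤ (2 * d) ^ k * h y) (by simp)
    (by
      intro k y i _ hy' hh
      have := (step _ hy' i).2
      simp only [add_sub_cancel_right] at this
      rw [pow_succ, mul_assoc]
      exact hh.trans (by gcongr))
    (by
      intro k y i _ hy' hh
      have := (step _ hy' i).1
      simp only [sub_add_cancel] at this
      rw [pow_succ, mul_assoc]
      exact hh.trans (by gcongr)) y hy
  refine hP.trans ?_
  have hd : d = 0 ∨ 1 ≤ d := by omega
  rcases hd with rfl | hd
  · have : k = 0 := by simpa using hk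
    subst this; simp
  · have : (1 : ℝ) ≤ 2 * d := by
      have : (1 : ℝ) ≤ d := by exact_mod_cast hd
      linarith
    gcongr
    exact h0 _

lemma cosh_ge (x : ℝ) : 2 + x ^ 2 ≤ Real.exp x + Real.exp (-x) := by
  have key : ∀ x : ℝ, 0 ≤ x → 2 + x ^ 2 ≤ Real.exp x + Real.exp (-x) := by
    intro x hx
    have h1 : x / 2 ≤ Real.sinh (x / 2) := Real.self_le_sinh_iff.2 (by linarith)
    rw [Real.sinh_eq] at h1
    have e1 : Real.exp x = Real.exp (x / 2) * Real.exp (x / 2) := by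
      rw [← Real.exp_add]; congr 1; ring
    have e2 : Real.exp (-x) = Real.exp (-(x / 2)) * Real.exp (-(x / 2)) := by
      rw [← Real.exp_add]; congr 1; ring
    have e3 : Real.exp (x / 2) * Real.exp (-(x / 2)) = 1 := by
      rw [← Real.exp_add]; simp
    rw [e1, e2]
    nlinarith
  rcases le_total 0 x with h | h
  · exact key x h
  · have := key (-x) (by linarith)
    rw [neg_neg] at this
    linarith [neg_sq x]

/-- subharmonicity of the power barrier -/
lemma Lap_pow (x : V d) (hd : 2 ≤ d) (hx : (d : ℝ) ≤ nsq x) :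
    0 ≤ Lap (fun y => (nsq y)⁻¹ ^ d) x := by
  have hd1 : (2 : ℝ) ≤ d := by exact_mod_cast hd
  set v := nsq x with hv
  have hv0 : 0 < v := by linarith
  have base : ∀ t : ℝ, 0 ≤ t → v⁻¹ ^ d * Real.exp (- (d / v) * (t - v)) ≤ t⁻¹ ^ d ∨ t = 0 := by
    intro t ht
    rcases ht.eq_or_lt with h | h
    · exact Or.inr h.symm
    left
    have h1 : t / v ≤ Real.exp (t / v - 1) := by
      have := Real.add_one_le_exp (t / v - 1); linarith
    have h2 : (Real.exp (t / v - 1))⁻¹ ≤ (t / v)⁻¹ := inv_anti₀ (by positivity) h1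
    rw [← Real.exp_neg] at h2
    have h3 : (Real.exp (-(t / v - 1))) ^ d ≤ ((t / v)⁻¹) ^ d := by gcongr
    rw [← Real.exp_nat_mul] at h3
    calc v⁻¹ ^ d * Real.exp (- (d / v) * (t - v))
        = v⁻¹ ^ d * Real.exp (d * -(t / v - 1)) := by congr 2; field_simp
      _ ≤ v⁻¹ ^ d * ((t / v)⁻¹) ^ d := by gcongr
      _ = t⁻¹ ^ d := by rw [← mul_pow]; congr 1; field_simp
  set q := (d : ℝ) / v with hq
  have hq0 : 0 < q := by positivity
  have hq1 : q ≤ 1 := by rw [hq, div_le_one hv0]; exact hx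
  have hne : ∀ i, 0 < v + 2 * x i + 1 ∧ 0 < v - 2 * x i + 1 := by
    intro i
    have h1 := sq_le_nsq x i
    rw [← hv] at h1
    constructor
    · nlinarith [sq_nonneg ((x i : ℝ) + 1)]
    · nlinarith [sq_nonneg ((x i : ℝ) - 1)]
  have hterm : ∀ i, v⁻¹ ^ d * (Real.exp (-q) * (2 + (2 * q * x i) ^ 2) - 2)
      ≤ (nsq (x + ee i))⁻¹ ^ d + (nsq (x - ee i))⁻¹ ^ d - 2 * (nsq x)⁻¹ ^ d := by
    intro i
    rw [nsq_add, nsq_sub, ← hv]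
    have a1 := (base _ (hne i).1.le).resolve_right (hne i).1.ne'
    have a2 := (base _ (hne i).2.le).resolve_right (hne i).2.ne'
    have a3 := cosh_ge (2 * q * x i)
    have e1 : Real.exp (-q * (v + 2 * x i + 1 - v)) = Real.exp (-q) * Real.exp (-(2 * q * x i)) := by
      rw [← Real.exp_add]; congr 1; ring
    have e2 : Real.exp (-q * (v - 2 * x i + 1 - v)) = Real.exp (-q) * Real.exp (2 * q * x i) := by
      rw [← Real.exp_add]; congr 1; ring
    rw [e1] at a1
    rw [e2] at a2
    have a4 : v⁻¹ ^ d * (Real.exp (-q) * (2 + (2 * q * x i) ^ 2)) ≤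
        v⁻¹ ^ d * (Real.exp (-q) * (Real.exp (2 * q * x i) + Real.exp (-(2 * q * x i)))) := by
      gcongr
    linarith
  unfold Lap
  refine le_trans ?_ (Finset.sum_le_sum fun i _ => hterm i)
  rw [← Finset.mul_sum]
  apply mul_nonneg (by positivity)
  rw [Finset.sum_sub_distrib, ← Finset.mul_sum, Finset.sum_add_distrib]
  have e3 : ∑ i, (2 * q * (x i : ℝ)) ^ 2 = 4 * q * d := by
    simp only [mul_pow]
    rw [← Finset.mul_sum]
    change _ * nsq x = _
    rw [← hv, hq]; field_simp; ring
  rw [e3]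
  simp only [Finset.sum_const, Finset.card_univ, Fintype.card_fin, nsmul_eq_mul]
  have e4 : Real.exp q ≤ 1 + 2 * q := by
    have := Real.exp_bound' hq0.le hq1 (n := 2) (by norm_num)
    norm_num [Finset.sum_range_succ, Nat.factorial] at this
    nlinarith
  have e5 : 1 ≤ Real.exp (-q) * (1 + 2 * q) := by
    rw [Real.exp_neg, inv_mul_eq_div, le_div_iff₀ (Real.exp_pos _)]; linarith
  nlinarith

lemma nsq_ge_of_not_mem {x w : V d} {r : ℕ} (h : x ∉ cube w r) : ((r : ℝ) + 1) ^ 2 ≤ nsq (x - w) := by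
  simp only [cube, Set.mem_ofPred_eq, not_forall, not_le] at h
  obtain ⟨i, hi⟩ := h
  refine le_trans ?_ (sq_le_nsq (x - w) i)
  rw [← sq_abs (((x - w) i : ℤ) : ℝ)]
  have : (r : ℝ) + 1 ≤ |(((x - w) i : ℤ) : ℝ)| := by
    have : (r : ℤ) + 1 ≤ |(x - w) i| := by simp only [Pi.sub_apply]; omega
    exact_mod_cast this
  gcongr

lemma hit_bound (w : V d) (hd : 2 ≤ d) (s ρ : ℕ) (hs : d ≤ s) (h : V d → ℝ) (h0 : ∀ x, 0 ≤ h x)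
    (a : ℝ) (ha : 0 ≤ a) (hin : ∀ x ∈ cube w s, a ≤ h x)
    (harm : ∀ x ∈ cube w ρ, Lap h x = 0) (x : V d) (hx : x ∈ cube w ρ) (hxs : x ∉ cube w s)
    (hx2 : nsq (x - w) ≤ ((ρ : ℝ) + 1) ^ 2 / 4) :
    a * ((s : ℝ) / (ρ + 1)) ^ (2 * d) ≤ h x := by
  have hs0 : (0 : ℝ) < s := by exact_mod_cast (by omega : 0 < s)
  have hds : (d : ℝ) ≤ s := by exact_mod_cast hs
  have hd1 : (2 : ℝ) ≤ d := by exact_mod_cast hd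
  let C : ℝ := a * (s : ℝ) ^ (2 * d)
  have hC : 0 ≤ C := by positivity
  let u : V d → ℝ := fun y => (nsq y)⁻¹ ^ d
  let F : V d → ℝ := fun y => C * (u (y - w) - (((ρ : ℝ) + 1) ^ 2)⁻¹ ^ d) - h y
  have hLapF : ∀ y, Lap F y = C * Lap u (y - w) - Lap h y := by
    intro y
    unfold Lap
    rw [Finset.mul_sum, ← Finset.sum_sub_distrib]
    apply Finset.sum_congr rfl
    intro j _
    have e1 : y + ee j - w = y - w + ee j := by abel
    have e2 : y - ee j - w = y - w - ee j := by abel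
    simp only [F, e1, e2]; ring
  have key : ∀ y ∈ cube w ρ \ cube w s, F y ≤ 0 := by
    apply maxP (by omega) _ ((cube_finite w ρ).subset Set.sdiff_subset)
    · intro y hy
      rw [hLapF, harm y hy.1, sub_zero]
      apply mul_nonneg hC
      apply Lap_pow _ hd
      have := nsq_ge_of_not_mem hy.2
      nlinarith
    · have nb : ∀ y z : V d, y ∉ cube w s → (∃ i, z = y + ee i ∨ z = y - ee i) →
          z ∉ cube w ρ \ cube w s → F z ≤ 0 := by
        intro y z hy hz hzn
        by_cases hzs : z ∈ cube w s
        · have h1 := hin z hzs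
          have h2 : (s : ℝ) ^ 2 ≤ nsq (z - w) := by
            simp only [cube, Set.mem_ofPred_eq, not_forall, not_le] at hy
            obtain ⟨k, hk⟩ := hy
            have : (s : ℤ) ≤ |(z - w) k| := by
              obtain ⟨i, rfl | rfl⟩ := hz
              · by_cases hki : k = i
                · subst hki; simp only [Pi.sub_apply, Pi.add_apply, ee_same]
                  rw [lt_abs] at hk; rw [le_abs]; omega
                · simp only [Pi.sub_apply, Pi.add_apply, ee_ne hki]; rw [add_zero]; omega
              · by_cases hki : k = i
                · subst hki; simp only [Pi.sub_apply, ee_same]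
                  rw [lt_abs] at hk; rw [le_abs]; omega
                · simp only [Pi.sub_apply, ee_ne hki]; rw [sub_zero]; omega
            refine le_trans ?_ (sq_le_nsq (z - w) k)
            rw [← sq_abs (((z - w) k : ℤ) : ℝ)]
            have : (s : ℝ) ≤ |(((z - w) k : ℤ) : ℝ)| := by exact_mod_cast this
            gcongr
          have h3 : u (z - w) ≤ ((s : ℝ) ^ 2)⁻¹ ^ d := by
            have := nsq_nonneg (z - w)
            simp only [u]; gcongr
          have h4 : C * ((s : ℝ) ^ 2)⁻¹ ^ d = a := by
            simp only [C]; rw [pow_mul, mul_assoc, ← mul_pow, mul_inv_cancel₀ (by positivity)]; simp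
          have h5 : 0 ≤ C * (((ρ : ℝ) + 1) ^ 2)⁻¹ ^ d := by positivity
          have h6 := mul_le_mul_of_nonneg_left h3 hC
          simp only [F]; linarith
        · have hzr : z ∉ cube w ρ := fun hh => hzn ⟨hh, hzs⟩
          have h2 := nsq_ge_of_not_mem hzr
          have h3 : u (z - w) ≤ (((ρ : ℝ) + 1) ^ 2)⁻¹ ^ d := by
            have := nsq_nonneg (z - w)
            simp only [u]; gcongr
          have h6 := mul_nonneg hC (sub_nonneg.2 h3)
          have := h0 z
          simp only [F]; linarith
      intro y hy _ i
      exact ⟨nb y _ hy.2 ⟨i, Or.inl rfl⟩, nb y _ hy.2 ⟨i, Or.inr rfl⟩⟩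
  have h1 := key x ⟨hx, hxs⟩
  simp only [F] at h1
  set P := (((ρ : ℝ) + 1) ^ 2)⁻¹ ^ d with hP
  have hP0 : 0 < P := by positivity
  have hpos : 0 < nsq (x - w) := lt_of_lt_of_le (by positivity) (nsq_ge_of_not_mem hxs)
  have h2 : 2 * P ≤ u (x - w) := by
    have : (((ρ : ℝ) + 1) ^ 2 / 4)⁻¹ ^ d ≤ u (x - w) := by simp only [u]; gcongr
    refine le_trans ?_ this
    rw [inv_div, div_eq_mul_inv, mul_pow, ← hP]
    have : (2 : ℝ) ≤ 4 ^ d := by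
      calc (2 : ℝ) ≤ 4 ^ 1 := by norm_num
        _ ≤ 4 ^ d := pow_le_pow_right₀ (by norm_num) (by omega)
    gcongr
  have h3 : C * P ≤ h x := by nlinarith
  have h4 : a * ((s : ℝ) / (ρ + 1)) ^ (2 * d) = C * P := by
    simp only [C, hP]; rw [div_pow, inv_pow, ← pow_mul]; field_simp
  rw [h4]; exact h3

/-- sup norm -/
def nrm (w : V d) : ℕ := Finset.univ.sup fun i => (w i).natAbs

lemma mem_cube0_iff_nrm {w : V d} {r : ℕ} : w ∈ cube (0 : V d) r ↔ nrm w ≤ r := by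
  rw [mem_cube0]
  simp only [nrm, Finset.sup_le_iff, Finset.mem_univ, true_imp_iff]
  constructor <;> intro h i <;> have := h i <;> omega

lemma cube_sub {x y : V d} {r s t : ℕ} (h : y ∈ cube x r) (hst : r + s ≤ t) :
    cube y s ⊆ cube x t := by
  intro z hz i
  have h1 := abs_le.1 (h i)
  have h2 := abs_le.1 (hz i)
  rw [abs_le]; omega

lemma cube_mono {x : V d} {s t : ℕ} (hst : s ≤ t) : cube x s ⊆ cube x t := by
  intro z hz i
  have := hz i
  omega

lemma self_mem_cube (x : V d) (r : ℕ) : x ∈ cube x r := by intro i; simp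

lemma nrm_self (w : V d) : w ∈ cube (0 : V d) (nrm w) := mem_cube0_iff_nrm.2 le_rfl

set_option maxHeartbeats 2000000 in
lemma harnack0 (hd : 2 ≤ d) : ∃ C : ℝ, 0 < C ∧ ∀ R : ℕ, 8 * d ≤ R → ∀ h : V d → ℝ,
    (∀ x, 0 ≤ h x) → (∀ x ∈ cube (0 : V d) R, Lap h x = 0) →
    ∀ y ∈ cube (0 : V d) (R / (8 * d)), h y ≤ C * h 0 := by
  have hdR : (2 : ℝ) ≤ d := by exact_mod_cast hd
  set K1 : ℕ := 32 * d ^ 2 * 4 ^ d with hK1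
  have hK1pos : 0 < K1 := by positivity
  set E : ℝ := (2 * d : ℝ) ^ (d * d) with hE
  have hE0 : 0 < E := by positivity
  refine ⟨(16 * d * K1 : ℝ) ^ (2 * d) * E, by positivity, ?_⟩
  intro R hR h h0 harm y hy
  set R' : ℕ := R / (4 * d) with hR'
  have hR'4 : 4 * d * R' ≤ R := Nat.mul_div_le R (4 * d)
  have hR'5 : R < 4 * d * (R' + 1) := by
    have := Nat.lt_mul_div_succ R (by omega : 0 < 4 * d)
    simpa [hR'] using this
  have hR'2 : 8 * R' ≤ R := by nlinarith
  have hR'd : R' + d ≤ R := by omega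
  have hyR : nrm y ≤ R' / 2 := by
    rw [← mem_cube0_iff_nrm]
    have : R' / 2 = R / (8 * d) := by rw [hR', Nat.div_div_eq_div_mul]; congr 1; ring
    rw [this]; exact hy
  set Φ : V d → ℝ := fun x => h x * ((R' + 1 - nrm x : ℕ) : ℝ) ^ (2 * d) with hΦ
  obtain ⟨w, hw, hmax⟩ := Set.exists_max_image (cube (0 : V d) R') Φ (cube_finite 0 R')
    ⟨0, self_mem_cube 0 R'⟩
  have hwn : nrm w ≤ R' := mem_cube0_iff_nrm.1 hw
  set M := h w with hM
  have hM0 : 0 ≤ M := h0 w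
  set δ : ℕ := R' + 1 - nrm w with hδ
  have hδ1 : 1 ≤ δ := by omega
  have hδR : (1 : ℝ) ≤ δ := by exact_mod_cast hδ1
  -- local upper bound
  have hloc : ∀ y ∈ cube w (δ / 2), y ∈ cube (0 : V d) R' ∧ h y ≤ 4 ^ d * M := by
    intro y hy
    have hy1 : y ∈ cube (0 : V d) (nrm w + δ / 2) := cube_sub (nrm_self w) le_rfl hy
    have hy2 : nrm y ≤ nrm w + δ / 2 := mem_cube0_iff_nrm.1 hy1
    have hy3 : y ∈ cube (0 : V d) R' := mem_cube0_iff_nrm.2 (by omega)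
    refine ⟨hy3, ?_⟩
    have h1 := hmax y hy3
    simp only [hΦ] at h1
    have h2 : (δ : ℝ) / 2 ≤ ((R' + 1 - nrm y : ℕ) : ℝ) := by
      rw [div_le_iff₀ (by norm_num)]
      exact_mod_cast (by omega : δ ≤ (R' + 1 - nrm y) * 2)
    have h3 : h y * ((δ : ℝ) / 2) ^ (2 * d) ≤ M * (δ : ℝ) ^ (2 * d) := by
      refine le_trans ?_ h1
      have := h0 y
      gcongr
    have h4 : ((δ : ℝ) / 2) ^ (2 * d) = (δ : ℝ) ^ (2 * d) / 4 ^ d := by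
      rw [div_pow, pow_mul 2 2 d]; norm_num
    rw [h4, mul_div_assoc', div_le_iff₀ (by positivity)] at h3
    have h5 : 0 < (δ : ℝ) ^ (2 * d) := by positivity
    nlinarith
  set ρ : ℕ := R - R' with hρ
  have hcw : cube w ρ ⊆ cube (0 : V d) R := cube_sub hw (by omega)
  have hE2 : (2 : ℝ) ≤ E := by
    have : (2 : ℝ) * d ≤ E := by
      rw [hE]; exact le_self_pow₀ (by linarith) (by positivity)
    linarith
  have hs : ∃ s : ℕ, d ≤ s ∧ s ≤ ρ + 1 ∧ δ ≤ 2 * K1 * s ∧ ∀ y ∈ cube w s, E⁻¹ * M ≤ h y := by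
    by_cases hcase : d * K1 ≤ δ
    · refine ⟨δ / K1, ?_, ?_, ?_, ?_⟩
      · rw [Nat.le_div_iff_mul_le hK1pos]; exact hcase
      · have := Nat.div_le_self δ K1; omega
      · have h1 := Nat.lt_mul_div_succ δ hK1pos
        have h2 : 1 ≤ δ / K1 := by
          rw [Nat.le_div_iff_mul_le hK1pos]; nlinarith
        nlinarith
      · have hK32 : 32 ≤ K1 := by
          rw [hK1]
          have : 1 ≤ d ^ 2 * 4 ^ d := Nat.one_le_iff_ne_zero.2 (by positivity)
          nlinarith
        have hδ32 : 32 ≤ δ := by nlinarith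
        set s := δ / K1 with hs
        have hs16 : K1 * s ≤ δ := Nat.mul_div_le δ K1
        set r := δ / 8 with hr
        have hr1 : 1 ≤ r := by omega
        have hsr : 2 * d ^ 2 * 4 ^ d * s ≤ r := by
          rw [hr, Nat.le_div_iff_mul_le (by norm_num)]
          rw [hK1] at hs16
          nlinarith
        have hsr2 : s + (r + 1) ≤ δ / 2 := by
          have : 16 * s ≤ δ := by nlinarith
          omega
        have hgrad : ∀ y i, y ∈ cube w s → |h (y + ee i) - h y| ≤ (4 ^ d * M) * d / r := by
          intro y i hy
          have hsub : cube y (r + 1) ⊆ cube w (δ / 2) := cube_sub hy hsr2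
          apply grad i y r hr1
          · intro x hx
            apply harm
            apply cube_mono (by omega : R' ≤ R)
            exact (hloc x (hsub (cube_mono (by omega) hx))).1
          · intro x hx
            exact ⟨h0 x, (hloc x (hsub hx)).2⟩
        intro y hy
        have h1 := box_lip w s h ((4 ^ d * M) * d / r) (by positivity) hgrad y hy
        have h2 : (d : ℝ) * s * ((4 ^ d * M) * d / r) ≤ M / 2 := by
          have hrR : (0 : ℝ) < r := by exact_mod_cast hr1
          have : (2 : ℝ) * d ^ 2 * 4 ^ d * s ≤ r := by exact_mod_cast hsr
          rw [mul_div_assoc', div_le_div_iff₀ hrR (by norm_num)]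
          nlinarith
        have h3 := (abs_le.1 h1).1
        have h4 : E⁻¹ * M ≤ M / 2 := by
          rw [inv_mul_eq_div]; gcongr
        linarith
    · refine ⟨d, le_rfl, by omega, by nlinarith, ?_⟩
      intro y hy
      have := crude w d h h0 (fun x hx => harm x (cube_sub hw hR'd hx)) y hy
      rw [inv_mul_le_iff₀ hE0]
      exact this
  obtain ⟨s, hds, hsρ, hδs, hin⟩ := hs
  have hρ0 : (0 : ℝ) < (ρ : ℝ) + 1 := by positivity
  have hmain : E⁻¹ * M * ((s : ℝ) / (ρ + 1)) ^ (2 * d) ≤ h 0 := by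
    by_cases h0s : (0 : V d) ∈ cube w s
    · have h1 := hin 0 h0s
      have h2 : ((s : ℝ) / (ρ + 1)) ^ (2 * d) ≤ 1 := by
        apply pow_le_one₀ (by positivity)
        rw [div_le_one hρ0]; exact_mod_cast hsρ
      have h3 : 0 ≤ E⁻¹ * M := by positivity
      nlinarith
    · apply hit_bound w hd s ρ hds h h0 (E⁻¹ * M) (by positivity) hin
        (fun x hx => harm x (hcw hx)) 0 _ h0s
      · have h1 : nsq ((0 : V d) - w) ≤ d * (R' : ℝ) ^ 2 := by
          unfold nsq
          calc ∑ i, ((((0 : V d) - w) i : ℤ) : ℝ) ^ 2 ≤ ∑ _i : Fin d, (R' : ℝ) ^ 2 := by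
                apply Finset.sum_le_sum
                intro i _
                have := hw i
                simp only [Pi.zero_apply, sub_zero] at this
                rw [← sq_abs]
                have : |((((0 : V d) - w) i : ℤ) : ℝ)| ≤ R' := by
                  simp only [Pi.sub_apply, Pi.zero_apply, zero_sub]
                  push_cast
                  rw [abs_neg]; exact_mod_cast this
                gcongr
            _ = d * (R' : ℝ) ^ 2 := by simp
        refine h1.trans ?_
        have h2 : (2 * d * R' : ℝ) ≤ ρ + 1 := by
          have : 2 * d * R' ≤ ρ + 1 := by
            have : R' + 2 * d * R' ≤ 4 * d * R' := by nlinarith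
            omega
          exact_mod_cast this
        have h3 : (2 * d * R' : ℝ) ^ 2 ≤ (ρ + 1 : ℝ) ^ 2 := by gcongr
        have h4 : (0 : ℝ) ≤ (R' : ℝ) ^ 2 := sq_nonneg _
        nlinarith [mul_nonneg (by nlinarith : (0 : ℝ) ≤ d ^ 2 - d) h4]
      · intro i
        have := hw i
        simp only [Pi.zero_apply, sub_zero] at this
        simp only [Pi.zero_apply, zero_sub, abs_neg]
        omega
  -- final comparison
  have hyΦ := hmax y (mem_cube0_iff_nrm.2 (by omega))
  simp only [hΦ] at hyΦ
  have h2 : ((R' : ℝ) + 1) / 2 ≤ ((R' + 1 - nrm y : ℕ) : ℝ) := by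
    rw [div_le_iff₀ (by norm_num)]
    exact_mod_cast (by omega : R' + 1 ≤ (R' + 1 - nrm y) * 2)
  have h3 : h y * (((R' : ℝ) + 1) / 2) ^ (2 * d) ≤ M * (δ : ℝ) ^ (2 * d) := by
    refine le_trans ?_ hyΦ
    have := h0 y
    gcongr
  have h4 : (δ : ℝ) ≤ 2 * K1 * s := by exact_mod_cast hδs
  have h5 : (ρ : ℝ) + 1 ≤ 4 * d * (R' + 1) := by
    have : ρ + 1 ≤ 4 * d * (R' + 1) := by omega
    exact_mod_cast this
  have h6 : (s : ℝ) ^ (2 * d) * M ≤ E * (4 * d * (R' + 1)) ^ (2 * d) * h 0 := by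
    rw [div_pow, mul_assoc, inv_mul_le_iff₀ hE0, mul_div_assoc', div_le_iff₀ (by positivity)] at hmain
    calc (s : ℝ) ^ (2 * d) * M = M * (s : ℝ) ^ (2 * d) := by ring
      _ ≤ E * h 0 * ((ρ : ℝ) + 1) ^ (2 * d) := hmain
      _ ≤ E * h 0 * (4 * d * (R' + 1)) ^ (2 * d) := by
          have := h0 0
          gcongr
      _ = _ := by ring
  have h7 : h y * (((R' : ℝ) + 1) / 2) ^ (2 * d) ≤
      ((16 * d * K1 : ℝ) ^ (2 * d) * E * h 0) * (((R' : ℝ) + 1) / 2) ^ (2 * d) := by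
    calc _ ≤ M * (δ : ℝ) ^ (2 * d) := h3
      _ ≤ M * (2 * K1 * s) ^ (2 * d) := by gcongr
      _ = (2 * K1) ^ (2 * d) * ((s : ℝ) ^ (2 * d) * M) := by rw [mul_pow]; ring
      _ ≤ (2 * K1) ^ (2 * d) * (E * (4 * d * (R' + 1)) ^ (2 * d) * h 0) := by gcongr
      _ = (E * h 0) * ((2 * K1) * (4 * d * (R' + 1))) ^ (2 * d) := by
          rw [mul_pow (2 * (K1 : ℝ))]; ring
      _ = (E * h 0) * ((16 * d * K1) * ((R' + 1) / 2)) ^ (2 * d) := by congr 2; ring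
      _ = _ := by rw [mul_pow]; ring
  exact le_of_mul_le_mul_right h7 (by positivity)

lemma harnack1 (hd : 2 ≤ d) : ∃ C : ℝ, 0 < C ∧ ∀ (x : V d) (R : ℕ), 8 * d ≤ R → ∀ h : V d → ℝ,
    (∀ x, 0 ≤ h x) → (∀ z ∈ cube x R, Lap h z = 0) →
    ∀ y ∈ cube x (R / (8 * d)), h y ≤ C * h x := by
  obtain ⟨C, hC, H⟩ := harnack0 (d := d) hd
  refine ⟨C, hC, fun x R hR h h0 harm y hy => ?_⟩
  have := H R hR (fun z => h (x + z)) (fun z => h0 _)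
    (fun z hz => by rw [Lap_shift]; exact harm _ (mem_cube_shift.2 hz)) (y - x)
    (by rw [← mem_cube_shift (w := x)]; simpa using hy)
  simpa using this

lemma harnack_chain (C : ℝ) (hC : 1 ≤ C) (h : V d → ℝ) (x1 : V d) (q ρ : ℕ) (h0 : ∀ x, 0 ≤ h x)
    (H : ∀ x ∈ cube x1 q, ∀ y ∈ cube x ρ, h y ≤ C * h x) :
    ∀ k : ℕ, ∀ z ∈ cube x1 q, ∀ w ∈ cube x1 q, w ∈ cube z (k * ρ) → h w ≤ C ^ k * h z := by
  intro k
  induction k with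
  | zero =>
    intro z _ w _ hwz
    have : w = z := by
      funext i
      have := hwz i
      simp at this
      omega
    rw [this]; simp
  | succ k ih =>
    intro z hz w hw hwz
    let z' : V d := fun i => max (z i - ρ) (min (z i + ρ) (w i))
    have hz'1 : z' ∈ cube z ρ := by
      intro i; simp only [z']; rw [abs_le]; omega
    have hz'2 : z' ∈ cube x1 q := by
      intro i
      have h1 := abs_le.1 (hz i)
      have h2 := abs_le.1 (hw i)
      simp only [z']; rw [abs_le]; omega
    have hz'3 : w ∈ cube z' (k * ρ) := by
      intro i
      have h1 := abs_le.1 (hwz i)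
      rw [add_mul, one_mul] at h1
      push_cast at h1
      have h3 : (0 : ℤ) ≤ (k : ℤ) * ρ := by positivity
      simp only [z']; rw [abs_le]; push_cast
      omega
    calc h w ≤ C ^ k * h z' := ih z' hz'2 w hw hz'3
      _ ≤ C ^ k * (C * h z) := by
          have := H z hz z' hz'1
          gcongr
      _ = _ := by ring

/-- The Harnack inequality in the form used below. -/
lemma harnack (hd : 2 ≤ d) : ∃ C : ℝ, 0 < C ∧ ∀ (x1 : V d) (m : ℕ), 200 * d ≤ m → ∀ h : V d → ℝ,
    (∀ x, 0 ≤ h x) → (∀ z ∈ cube x1 (m / 2 - 1), Lap h z = 0) →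
    ∀ z ∈ cube x1 (m / 4), ∀ w ∈ cube x1 (m / 4), h w ≤ C * h z := by
  obtain ⟨C, hC, H⟩ := harnack1 (d := d) hd
  refine ⟨(max C 1) ^ (200 * d), by positivity, ?_⟩
  intro x1 m hm h h0 harm z hz w hw
  set R := m / 8 with hR
  have hρ : m < 64 * d * (R / (8 * d) + 1) + 64 * d := by
    have := Nat.lt_mul_div_succ R (by omega : 0 < 8 * d)
    have h2 : m < 8 * R + 8 := by omega
    nlinarith
  set ρ := R / (8 * d) with hρ'
  have hρ1 : 1 ≤ ρ := by
    rw [hρ', Nat.le_div_iff_mul_le (by omega)]; omega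
  apply harnack_chain (max C 1) (le_max_right _ _) h x1 (m / 4) ρ h0 _ (200 * d) z hz w hw
  · intro i
    have h1 := abs_le.1 (hz i)
    have h2 := abs_le.1 (hw i)
    have h3 : m / 4 + m / 4 ≤ 200 * d * ρ := by
      have : 64 * d * (ρ + 1) + 64 * d ≤ 200 * d * ρ := by nlinarith
      omega
    rw [abs_le]
    have h4 : ((m / 4 : ℕ) : ℤ) + ((m / 4 : ℕ) : ℤ) ≤ ((200 * d * ρ : ℕ) : ℤ) := by exact_mod_cast h3
    constructor <;> linarith
  · intro x hx y hy
    have := H x R (by omega) h h0 (fun u hu => harm u (cube_sub hx (by omega) hu)) y hy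
    refine this.trans ?_
    have := h0 x
    gcongr
    exact le_max_left _ _

lemma quart (t : ℝ) (h1 : -(1 / 50) ≤ t) (h2 : t ≤ 1 / 50) :
    (1 + t) ^ (-(1 / 4) : ℝ) ≤ 1 - t / 4 + t ^ 2 / 6 := by
  have hp : 0 < 1 + t := by linarith
  have hP : 0 ≤ 1 - t / 4 + t ^ 2 / 6 := by nlinarith
  have e : ((1 + t) ^ (-(1 / 4) : ℝ)) ^ 4 = (1 + t)⁻¹ := by
    rw [← Real.rpow_natCast, ← Real.rpow_mul hp.le]
    norm_num
    rw [Real.rpow_neg_one]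
  rw [← pow_le_pow_iff_left₀ (by positivity) hP (by norm_num : 4 ≠ 0), e]
  rw [inv_le_iff_one_le_mul₀ hp]
  have habs : |t| ≤ 1 / 50 := abs_le.2 ⟨by linarith, h2⟩
  have step : ∀ a u : ℝ, |a| ≤ 1 / 2 → |u| ≤ 1 → |a + t * u| ≤ 1 := by
    intro a u ha hu
    calc |a + t * u| ≤ |a| + |t| * |u| := by rw [← abs_mul]; exact abs_add_le _ _
      _ ≤ 1 / 2 + 1 / 50 * 1 := by gcongr
      _ ≤ 1 := by norm_num
  have hR : |23 / 48 + t * (-205 / 768 + t * (155 / 768 + t * (-7 / 108 + t * (7 / 288 +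
      t * (-5 / 1296 + t * (1 / 1296))))))| ≤ 1 := by
    repeat' apply step
    all_goals (rw [abs_le]; constructor <;> norm_num)
  set R := 23 / 48 + t * (-205 / 768 + t * (155 / 768 + t * (-7 / 108 + t * (7 / 288 +
      t * (-5 / 1296 + t * (1 / 1296)))))) with hRd
  have e2 : (1 - t / 4 + t ^ 2 / 6) ^ 4 * (1 + t) = 1 + t ^ 2 * (1 / 24 + t * R) := by
    rw [hRd]; ring
  have h3 : |t * R| ≤ 1 / 50 * 1 := by rw [abs_mul]; gcongr
  have h4 := (abs_le.1 h3).1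
  have : 0 ≤ t ^ 2 * (1 / 24 + t * R) := mul_nonneg (sq_nonneg _) (by linarith)
  rw [e2]; linarith

lemma occ (hd : 3 ≤ d) : ∃ C : ℝ, 0 < C ∧ ∀ (c : V d) (m : ℕ), 1 ≤ m → ∃ f : V d → ℝ,
    (∀ x, 0 ≤ f x ∧ f x ≤ C * (m : ℝ) ^ 2) ∧
    ∀ x, Lap f x + (if x ∈ cube c m then 2 * (d : ℝ) else 0) ≤ 0 := by
  have hd' : (3 : ℝ) ≤ d := by exact_mod_cast hd
  refine ⟨288 * (10000 * d), by positivity, fun c m hm => ?_⟩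
  have hm' : (1 : ℝ) ≤ m := by exact_mod_cast hm
  set a : ℝ := 10000 * d * (m : ℝ) ^ 2 with ha
  have ha1 : 10000 ≤ a := by
    have : (1 : ℝ) ≤ (m : ℝ) ^ 2 := one_le_pow₀ hm'
    nlinarith
  have hapos : 0 < a := by linarith
  refine ⟨fun x => 288 * a * ((a + nsq (x - c)) / a) ^ (-(1 / 4) : ℝ), fun x => ⟨?_, ?_⟩, ?_⟩
  · have := nsq_nonneg (x - c)
    positivity
  · have := nsq_nonneg (x - c)
    have h1 : ((a + nsq (x - c)) / a) ^ (-(1 / 4) : ℝ) ≤ 1 := by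
      apply Real.rpow_le_one_of_one_le_of_nonpos
      · rw [le_div_iff₀ hapos]; linarith
      · norm_num
    calc 288 * a * ((a + nsq (x - c)) / a) ^ (-(1 / 4) : ℝ) ≤ 288 * a * 1 := by gcongr
      _ = _ := by rw [ha]; ring
  · intro x
    have hn := nsq_nonneg (x - c)
    set y := x - c with hy
    set v := a + nsq y with hv
    have hvpos : 0 < v := by linarith
    set g := (v / a) ^ (-(1 / 4) : ℝ) with hg
    have hgpos : 0 < g := by positivity
    have key : ∀ s t : ℝ, s = v * (1 + t) → |t| ≤ 1 / 50 →
        (s / a) ^ (-(1 / 4) : ℝ) ≤ g * (1 - t / 4 + t ^ 2 / 6) := by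
      intro s t hs ht
      have ht' := abs_le.1 ht
      rw [hs, mul_div_right_comm, Real.mul_rpow (by positivity) (by linarith)]
      gcongr
      exact quart t (by linarith) ht'.2
    have hL : Lap (fun x => 288 * a * ((a + nsq (x - c)) / a) ^ (-(1 / 4) : ℝ)) x
        ≤ 288 * a * g * (-(d / (36 * v))) := by
      have h1 : ∀ i : Fin d, 288 * a * ((a + nsq (x + ee i - c)) / a) ^ (-(1 / 4) : ℝ)
          + 288 * a * ((a + nsq (x - ee i - c)) / a) ^ (-(1 / 4) : ℝ)
          - 2 * (288 * a * ((a + nsq (x - c)) / a) ^ (-(1 / 4) : ℝ))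
          ≤ 288 * a * g * (-(1 / (2 * v)) + (1 + 4 * (y i : ℝ) ^ 2) / (3 * v ^ 2)) := by
        intro i
        have hyi := sq_le_nsq y i
        have e1 : x + ee i - c = y + ee i := by rw [hy]; abel
        have e2 : x - ee i - c = y - ee i := by rw [hy]; abel
        rw [e1, e2, nsq_add, nsq_sub, ← hy, ← hv, ← hg]
        have k1 := key (a + (nsq y + 2 * y i + 1)) ((1 + 2 * y i) / v)
          (by field_simp; rw [hv]; ring)
          (by
            rw [abs_div, abs_of_pos hvpos, div_le_iff₀ hvpos, abs_le]
            constructor <;> nlinarith [sq_nonneg ((y i : ℝ) - 100), sq_nonneg ((y i : ℝ) + 100)])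
        have k2 := key (a + (nsq y - 2 * y i + 1)) ((1 - 2 * y i) / v)
          (by field_simp; rw [hv]; ring)
          (by
            rw [abs_div, abs_of_pos hvpos, div_le_iff₀ hvpos, abs_le]
            constructor <;> nlinarith [sq_nonneg ((y i : ℝ) - 100), sq_nonneg ((y i : ℝ) + 100)])
        have k3 : g * (1 - ((1 + 2 * y i) / v) / 4 + ((1 + 2 * y i) / v) ^ 2 / 6)
          + g * (1 - ((1 - 2 * y i) / v) / 4 + ((1 - 2 * y i) / v) ^ 2 / 6) - 2 * g
          = g * (-(1 / (2 * v)) + (1 + 4 * (y i : ℝ) ^ 2) / (3 * v ^ 2)) := by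
          field_simp; ring
        rw [mul_assoc (288 * a) g, ← k3]
        have : (0 : ℝ) ≤ 288 * a := by positivity
        have := mul_le_mul_of_nonneg_left (add_le_add k1 k2) this
        linarith
      unfold Lap
      refine (Finset.sum_le_sum fun i _ => h1 i).trans ?_
      rw [← Finset.mul_sum]
      apply mul_le_mul_of_nonneg_left _ (by positivity)
      rw [Finset.sum_add_distrib, ← Finset.sum_div, Finset.sum_add_distrib, ← Finset.mul_sum]
      change _ + (_ + 4 * nsq y) / _ ≤ _
      simp only [Finset.sum_const, Finset.card_univ, Fintype.card_fin, nsmul_eq_mul]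
      have h5 : 4 * nsq y ≤ 4 * d / 3 * v := by nlinarith
      have h6 : (d * 1 + 4 * nsq y) / (3 * v ^ 2) ≤ (d * (v / 12) + 4 * d / 3 * v) / (3 * v ^ 2) := by
        gcongr
        linarith
      refine (add_le_add_right h6 _).trans ?_
      apply le_of_eq
      field_simp; ring
    have hf : (fun x => 288 * a * ((a + nsq (x - c)) / a) ^ (-(1 / 4) : ℝ)) =
      (fun x => 288 * a * ((a + nsq (x - c)) / a) ^ (-(1 / 4) : ℝ)) := rfl
    split_ifs with hx
    · have hny : nsq y ≤ a := by
        have : nsq y ≤ ∑ i : Fin d, (m : ℝ) ^ 2 := by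
          unfold nsq
          apply Finset.sum_le_sum
          intro i _
          have := hx i
          rw [← sq_abs]
          have h' : |((y i : ℤ) : ℝ)| ≤ m := by
            rw [hy]; exact_mod_cast this
          gcongr
        rw [Finset.sum_const, Finset.card_univ, Fintype.card_fin, nsmul_eq_mul] at this
        have : 0 ≤ (d : ℝ) * (m : ℝ) ^ 2 := by positivity
        rw [ha]; linarith
      have hg2 : 1 / 2 ≤ g := by
        have h1 : v / a ≤ 2 := by rw [div_le_iff₀ hapos]; linarith
        have h2 : (2 : ℝ) ^ (-(1 / 4) : ℝ) ≤ g :=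
          Real.rpow_le_rpow_of_nonpos (by positivity) h1 (by norm_num)
        have h3 : (2 : ℝ) ^ (-1 : ℝ) ≤ (2 : ℝ) ^ (-(1 / 4) : ℝ) :=
          Real.rpow_le_rpow_of_exponent_le (by norm_num) (by norm_num)
        rw [Real.rpow_neg_one] at h3
        linarith
      have : 2 * (d : ℝ) ≤ 288 * a * g * (d / (36 * v)) := by
        rw [mul_div_assoc', le_div_iff₀ (by positivity)]
        have : 72 * v ≤ 288 * a * g := by nlinarith
        nlinarith
      linarith
    · have : 0 ≤ 288 * a * g * (d / (36 * v)) := by positivity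
      linarith

/-- cylinder -/
def cyl (γ : ℕ → V d) (n : ℕ) : Set (ℕ → V d) := { ω | ∀ i ≤ n, ω i = γ i }

/-- property of first coordinates -/
def Adapted {β : Type*} (s : ℕ) (g : (ℕ → V d) → β) : Prop :=
  ∀ ω ω', (∀ i ≤ s, ω i = ω' i) → g ω = g ω'

/-- extend a finite word -/
def extw (s : ℕ) (v : Fin (s + 1) → V d) : ℕ → V d := fun i => if h : i < s + 1 then v ⟨i, h⟩ else 0

lemma extw_apply (s : ℕ) (ω : ℕ → V d) (i : ℕ) (hi : i ≤ s) :
    extw s (fun j : Fin (s + 1) => ω j) i = ω i := by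
  simp [extw, Nat.lt_succ_of_le hi]

lemma measurable_restr (s : ℕ) : Measurable (fun (ω : ℕ → V d) (j : Fin (s + 1)) => ω j) :=
  measurable_pi_lambda _ fun _ => measurable_pi_apply _

lemma Adapted.measurable {β : Type*} [MeasurableSpace β] {s : ℕ} {g : (ℕ → V d) → β}
    (h : Adapted s g) : Measurable g := by
  have : g = (fun v => g (extw s v)) ∘ (fun (ω : ℕ → V d) (j : Fin (s + 1)) => ω j) := by
    funext ω
    exact h _ _ fun i hi => (extw_apply s ω i hi).symm
  rw [this]
  exact (measurable_of_countable _).comp (measurable_restr s)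

lemma Adapted.measurableSet {s : ℕ} {E : Set (ℕ → V d)} (h : Adapted s (· ∈ E)) :
    MeasurableSet E := by
  have := h.measurable
  exact measurableSet_setOfPred.2 this

lemma cyl_adapted (γ : ℕ → V d) (n : ℕ) : Adapted n (· ∈ cyl γ n) := by
  intro ω ω' h
  simp only [cyl, Set.mem_ofPred_eq, eq_iff_iff]
  exact forall₂_congr fun i hi => by rw [h i hi]

lemma measurableSet_cyl (γ : ℕ → V d) (n : ℕ) : MeasurableSet (cyl γ n) :=
  (cyl_adapted γ n).measurableSet

lemma ext_cyl (μ ν : Measure (ℕ → V d)) [IsFiniteMeasure μ]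
    (h : ∀ γ n, μ (cyl γ n) = ν (cyl γ n)) : μ = ν := by
  let P : (I : Finset ℕ) → Measure ((i : I) → V d) := fun I => μ.map I.restrict
  have hP : IsProjectiveMeasureFamily (α := fun _ : ℕ => V d) P := by
    intro I J hJI
    simp only [P]
    rw [Measure.map_map (Finset.measurable_restrict₂ hJI) (Finset.measurable_restrict I)]
    rfl
  have h1 : IsProjectiveLimit (α := fun _ : ℕ => V d) μ P := fun I => rfl
  have h2 : IsProjectiveLimit (α := fun _ : ℕ => V d) ν P := by
    rw [isProjectiveLimit_nat_iff hP]
    intro n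
    rw [Measure.ext_iff_singleton]
    intro v
    simp only [P]
    rw [Measure.map_apply (Preorder.measurable_frestrictLe n) (measurableSet_singleton _),
      Measure.map_apply (Finset.measurable_restrict _) (measurableSet_singleton _)]
    let γ : ℕ → V d := fun i => if h : i ∈ Finset.Iic n then v ⟨i, h⟩ else 0
    have e : (Finset.Iic n).restrict (π := fun _ => V d) ⁻¹' {v} = cyl γ n := by
      ext ω
      simp only [Set.mem_preimage, Set.mem_singleton_iff, cyl, Set.mem_ofPred_eq]
      constructor
      · intro h i hi
        have : γ i = v ⟨i, Finset.mem_Iic.2 hi⟩ := dif_pos (Finset.mem_Iic.2 hi)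
        rw [this, ← h]; rfl
      · intro h
        funext ⟨i, hi⟩
        have : γ i = v ⟨i, hi⟩ := dif_pos hi
        rw [← this, ← h i (Finset.mem_Iic.1 hi)]; rfl
    change ν ((Finset.Iic n).restrict ⁻¹' {v}) = _
    rw [e, h]
  have : ∀ I, IsFiniteMeasure (P I) := fun I => by
    constructor
    simp only [P]
    rw [Measure.map_apply (Finset.measurable_restrict I) MeasurableSet.univ]
    exact measure_lt_top _ _
  exact h1.unique h2

/-- steps -/
def stp (e : Fin d × Bool) : V d := if e.2 then ee e.1 else - ee e.1

lemma stp_inj : Function.Injective (stp : Fin d × Bool → V d) := by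
  rintro ⟨i, b⟩ ⟨j, b'⟩ h
  have hi := congrFun h i
  have hj := congrFun h j
  by_cases hij : i = j
  · subst hij
    cases b <;> cases b' <;> simp [stp, ee] at hi ⊢
  · exfalso
    cases b <;> cases b' <;> simp [stp, ee, hij] at hi

lemma adj_iff (x y : V d) : adj x y ↔ ∃ e, y = x + stp e := by
  constructor
  · intro h
    unfold adj at h
    have : ∃ i, |x i - y i| ≠ 0 := by
      by_contra! hc
      simp [hc] at h
    obtain ⟨i, hi⟩ := this
    rw [← Finset.add_sum_erase _ _ (Finset.mem_univ i)] at h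
    have h0 : 0 ≤ ∑ j ∈ Finset.univ.erase i, |x j - y j| := Finset.sum_nonneg fun _ _ => abs_nonneg _
    have h1 : 0 < |x i - y i| := lt_of_le_of_ne (abs_nonneg _) (Ne.symm hi)
    have h2 : ∑ j ∈ Finset.univ.erase i, |x j - y j| = 0 := by omega
    rw [Finset.sum_eq_zero_iff_of_nonneg fun _ _ => abs_nonneg _] at h2
    have h3 : ∀ j, j ≠ i → y j = x j := fun j hj => by
      have := h2 j (by simp [hj])
      rw [abs_eq_zero] at this; omega
    have h4 : |x i - y i| = 1 := by omega
    rcases (abs_eq (by norm_num)).1 h4 with h5 | h5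
    · refine ⟨(i, false), funext fun j => ?_⟩
      by_cases hj : j = i
      · subst hj; simp [stp, ee]; omega
      · simp [stp, ee, hj, h3 j hj]
    · refine ⟨(i, true), funext fun j => ?_⟩
      by_cases hj : j = i
      · subst hj; simp [stp, ee]; omega
      · simp [stp, ee, hj, h3 j hj]
  · rintro ⟨⟨i, b⟩, rfl⟩
    unfold adj
    rw [Finset.sum_eq_single i]
    · cases b <;> simp [stp, ee]
    · intro j _ hj
      cases b <;> simp [stp, ee, hj]
    · simp

lemma two_d_ne (hd : 3 ≤ d) : (2 * (d : ℝ≥0∞)) ≠ 0 := by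
  simp; omega
lemma two_d_ne_top : (2 * (d : ℝ≥0∞)) ≠ ⊤ := by
  exact ENNReal.mul_ne_top (by norm_num) (by simp)

lemma card_stp : (Fintype.card (Fin d × Bool) : ℝ≥0∞) = 2 * d := by
  simp [mul_comm]

lemma IsSRWLaw.ae_nn (hd : 3 ≤ d) {μ : Measure (ℕ → V d)} (h : IsSRWLaw μ 0) :
    ∀ᵐ ω ∂μ, ω 0 = 0 ∧ ∀ i, adj (ω i) (ω (i + 1)) := by
  have := h.1
  have main : ∀ n : ℕ, ∀ᵐ ω ∂μ, ω 0 = 0 ∧ ∀ i < n, adj (ω i) (ω (i + 1)) := by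
    intro n
    induction n with
    | zero =>
      have h0 := h.2 0 (fun _ => 0) rfl (by simp)
      rw [pow_zero] at h0
      have : ∀ᵐ ω ∂μ, ω ∈ cyl (fun _ => (0 : V d)) 0 :=
        (prob_compl_eq_zero_iff (measurableSet_cyl _ _)).2 h0
      filter_upwards [this] with ω hω
      exact ⟨hω 0 le_rfl, by simp⟩
    | succ n ih =>
      have key : ∀ v : Fin (n + 1) → V d, ∀ᵐ ω ∂μ, (extw n v 0 = 0 ∧ ∀ i < n, adj (extw n v i) (extw n v (i + 1))) →
          (ω ∈ cyl (extw n v) n) → adj (ω n) (ω (n + 1)) := by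
        intro v
        by_cases hv : extw n v 0 = 0 ∧ ∀ i < n, adj (extw n v i) (extw n v (i + 1))
        swap
        · exact Filter.Eventually.of_forall fun ω h => absurd h hv
        set γ := extw n v with hγ
        let γe : Fin d × Bool → ℕ → V d := fun e i => if i ≤ n then γ i else γ n + stp e
        have he : ∀ e, μ (cyl (γe e) (n + 1)) = (2 * (d : ℝ≥0∞))⁻¹ ^ (n + 1) := by
          intro e
          refine h.2 (n + 1) (γe e) (by simp [γe, hv.1]) ?_
          intro i hi
          by_cases hin : i < n
          · have h1 : i ≤ n := by omega
            have h2 : i + 1 ≤ n := by omega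
            simp only [γe, h1, h2, if_true]
            exact hv.2 i hin
          · have : i = n := by omega
            subst this
            simp only [γe, le_refl, if_true]
            rw [if_neg (by omega), adj_iff]
            exact ⟨e, rfl⟩
        have hU : μ (⋃ e, cyl (γe e) (n + 1)) = (2 * (d : ℝ≥0∞))⁻¹ ^ n := by
          rw [measure_iUnion _ (fun e => measurableSet_cyl _ _)]
          · simp only [he, tsum_fintype, Finset.sum_const, Finset.card_univ, nsmul_eq_mul]
            rw [card_stp, pow_succ, mul_comm, mul_assoc, ENNReal.inv_mul_cancel (two_d_ne hd) two_d_ne_top, mul_one]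
          · intro e e' hee
            rw [Function.onFun, Set.disjoint_left]
            intro ω h1 h2
            have h1 := h1 (n + 1) le_rfl
            have h2 := h2 (n + 1) le_rfl
            simp only [γe] at h1 h2
            rw [if_neg (by omega)] at h1 h2
            exact hee (stp_inj (add_left_cancel (h1.symm.trans h2)))
        have hsub : (⋃ e, cyl (γe e) (n + 1)) ⊆ cyl γ n := by
          intro ω hω
          obtain ⟨e, he⟩ := Set.mem_iUnion.1 hω
          intro i hi
          rw [he i (by omega)]; simp [γe, hi]
        have hdiff : μ (cyl γ n \ ⋃ e, cyl (γe e) (n + 1)) = 0 := by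
          rw [measure_sdiff hsub (MeasurableSet.iUnion fun e => measurableSet_cyl _ _).nullMeasurableSet (measure_ne_top _ _), hU]
          have : μ (cyl γ n) = _ := h.2 n γ hv.1 hv.2
          rw [this, tsub_self]
        have : ∀ᵐ ω ∂μ, ω ∉ (cyl γ n \ ⋃ e, cyl (γe e) (n + 1)) := measure_eq_zero_iff_ae_notMem.1 hdiff
        filter_upwards [this] with ω hω _ hc
        have : ω ∈ ⋃ e, cyl (γe e) (n + 1) := by
          by_contra hcon
          exact hω ⟨hc, hcon⟩
        obtain ⟨e, he⟩ := Set.mem_iUnion.1 this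
        rw [adj_iff]
        refine ⟨e, ?_⟩
        rw [he (n + 1) le_rfl, hc n le_rfl]; simp [γe]
      filter_upwards [ih, ae_all_iff.2 key] with ω h1 h2
      refine ⟨h1.1, fun i hi => ?_⟩
      rcases Nat.lt_succ_iff_lt_or_eq.1 hi with hi | rfl
      · exact h1.2 i hi
      · refine h2 (fun j => ω j) ⟨?_, ?_⟩ ?_
        · rw [extw_apply _ _ _ (by omega)]; exact h1.1
        · intro j hj
          rw [extw_apply _ _ _ (by omega), extw_apply _ _ _ (by omega)]; exact h1.2 j hj
        · intro j hj
          rw [extw_apply _ _ _ hj]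
  filter_upwards [ae_all_iff.2 main] with ω hω
  exact ⟨(hω 0).1, fun i => (hω (i + 1)).2 i (by omega)⟩

lemma IsSRWLaw.cyl_val (hd : 3 ≤ d) {μ : Measure (ℕ → V d)} (h : IsSRWLaw μ 0) (γ : ℕ → V d) (n : ℕ) :
    μ (cyl γ n) = if γ 0 = 0 ∧ ∀ i < n, adj (γ i) (γ (i + 1)) then (2 * (d : ℝ≥0∞))⁻¹ ^ n else 0 := by
  split_ifs with hc
  · exact h.2 n γ hc.1 hc.2
  · refine measure_mono_null (t := {ω | ¬ (ω 0 = 0 ∧ ∀ i, adj (ω i) (ω (i + 1)))}) ?_ (h.ae_nn hd)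
    intro ω hω hcon
    apply hc
    refine ⟨?_, fun i hi => ?_⟩
    · rw [← hω 0 (by omega)]; exact hcon.1
    · rw [← hω i (by omega), ← hω (i + 1) (by omega)]; exact hcon.2 i

/-- translated law -/
noncomputable def nu (μ : Measure (ℕ → V d)) (x : V d) : Measure (ℕ → V d) :=
  μ.map (fun ω j => ω j + x)

/-- time shift -/
def th (s : ℕ) (ω : ℕ → V d) : ℕ → V d := fun j => ω (s + j)

lemma measurable_th (s : ℕ) : Measurable (th s : (ℕ → V d) → _) :=
  measurable_pi_lambda _ fun _ => measurable_pi_apply _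

lemma measurable_tr (x : V d) : Measurable (fun (ω : ℕ → V d) j => ω j + x) :=
  measurable_pi_lambda _ fun j => (measurable_of_countable (fun y : V d => y + x)).comp (measurable_pi_apply j)

lemma nu_cyl (μ : Measure (ℕ → V d)) (x : V d) (γ : ℕ → V d) (n : ℕ) :
    nu μ x (cyl γ n) = μ (cyl (fun i => γ i - x) n) := by
  rw [nu, Measure.map_apply (measurable_tr x) (measurableSet_cyl _ _)]
  congr 1
  ext ω
  simp only [cyl, Set.mem_preimage, Set.mem_ofPred_eq, eq_sub_iff_add_eq]

lemma adj_sub (x y z : V d) : adj (x - z) (y - z) ↔ adj x y := by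
  simp [adj]

lemma restr_map (hd : 3 ≤ d) {μ : Measure (ℕ → V d)} (h : IsSRWLaw μ 0) (γ : ℕ → V d) (s : ℕ) :
    (μ.restrict (cyl γ s)).map (th s) = μ (cyl γ s) • nu μ (γ s) := by
  have := h.1
  apply ext_cyl
  intro γ' n
  rw [Measure.map_apply (measurable_th s) (measurableSet_cyl _ _),
    Measure.restrict_apply (measurable_th s (measurableSet_cyl _ _)),
    Measure.smul_apply, nu_cyl, smul_eq_mul]
  by_cases h0 : γ' 0 = γ s
  · let γ'' : ℕ → V d := fun i => if i ≤ s then γ i else γ' (i - s)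
    have g1 : ∀ i ≤ s, γ'' i = γ i := fun i hi => by simp [γ'', hi]
    have g2 : ∀ i, γ'' (s + i) = γ' i := fun i => by
      by_cases hi : i = 0
      · subst hi; simp [γ'', h0]
      · simp only [γ'']; rw [if_neg (by omega)]; congr 1; omega
    have e : th s ⁻¹' cyl γ' n ∩ cyl γ s = cyl γ'' (s + n) := by
      ext ω
      simp only [Set.mem_inter_iff, Set.mem_preimage, cyl, Set.mem_ofPred_eq, th]
      constructor
      · rintro ⟨h1, h2⟩ i hi
        by_cases his : i ≤ s
        · rw [g1 i his, h2 i his]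
        · obtain ⟨k, rfl⟩ := Nat.exists_eq_add_of_le (le_of_not_ge his)
          rw [g2, h1 k (by omega)]
      · intro h1
        exact ⟨fun i hi => by rw [h1 _ (by omega), g2], fun i hi => by rw [h1 _ (by omega), g1 i hi]⟩
    rw [e, h.cyl_val hd, h.cyl_val hd, h.cyl_val hd]
    have e2 : (γ'' 0 = 0 ∧ ∀ i < s + n, adj (γ'' i) (γ'' (i + 1))) ↔
      ((γ 0 = 0 ∧ ∀ i < s, adj (γ i) (γ (i + 1))) ∧
        (γ' 0 - γ s = 0 ∧ ∀ i < n, adj (γ' i - γ s) (γ' (i + 1) - γ s))) := by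
      simp only [adj_sub]
      constructor
      · rintro ⟨h1, h2⟩
        refine ⟨⟨by rw [← g1 0 (by omega)]; exact h1, fun i hi => ?_⟩, by rw [h0, sub_self], fun i hi => ?_⟩
        · rw [← g1 i (by omega), ← g1 (i + 1) (by omega)]; exact h2 i (by omega)
        · rw [← g2 i, ← g2 (i + 1)]; exact h2 (s + i) (by omega)
      · rintro ⟨⟨h1, h2⟩, _, h3⟩
        refine ⟨by rw [g1 0 (by omega)]; exact h1, fun i hi => ?_⟩
        by_cases his : i < s
        · rw [g1 i (by omega), g1 (i + 1) (by omega)]; exact h2 i his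
        · obtain ⟨k, rfl⟩ := Nat.exists_eq_add_of_le (le_of_not_gt his)
          rw [add_assoc, g2, g2]; exact h3 k (by omega)
    by_cases c1 : (γ 0 = 0 ∧ ∀ i < s, adj (γ i) (γ (i + 1)))
    · by_cases c2 : (γ' 0 - γ s = 0 ∧ ∀ i < n, adj (γ' i - γ s) (γ' (i + 1) - γ s))
      · rw [if_pos (e2.2 ⟨c1, c2⟩), if_pos c1, if_pos c2, pow_add]
      · rw [if_neg (fun hh => c2 (e2.1 hh).2), if_neg c2, mul_zero]
    · rw [if_neg (fun hh => c1 (e2.1 hh).1), if_neg c1, zero_mul]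
  · have e : th s ⁻¹' cyl γ' n ∩ cyl γ s = ∅ := by
      ext ω
      simp only [Set.mem_inter_iff, Set.mem_preimage, Set.mem_empty_iff_false, iff_false, not_and]
      intro h1 h2
      have := h1 0 (by omega)
      simp only [th, add_zero] at this
      exact h0 (by rw [← this, h2 s le_rfl])
    rw [e, measure_empty, h.cyl_val hd (fun i => γ' i - γ s), if_neg, mul_zero]
    rintro ⟨h1, _⟩
    exact h0 (sub_eq_zero.1 h1)

lemma markov0 (hd : 3 ≤ d) {μ : Measure (ℕ → V d)} (h : IsSRWLaw μ 0) (s : ℕ)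
    (g f : (ℕ → V d) → ℝ≥0∞) (hg : Adapted s g) (hf : Measurable f) :
    ∫⁻ ω, g ω * f (th s ω) ∂μ = ∫⁻ ω, g ω * (∫⁻ ω', f ω' ∂(nu μ (ω s))) ∂μ := by
  have part : ∀ F : (ℕ → V d) → ℝ≥0∞, ∫⁻ ω, F ω ∂μ = ∑' v : Fin (s + 1) → V d, ∫⁻ ω in cyl (extw s v) s, F ω ∂μ := by
    intro F
    rw [← lintegral_iUnion (fun v => measurableSet_cyl _ _)]
    · have : (⋃ v : Fin (s + 1) → V d, cyl (extw s v) s) = Set.univ := by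
        rw [Set.eq_univ_iff_forall]
        intro ω
        exact Set.mem_iUnion.2 ⟨fun j => ω j, fun i hi => (extw_apply s ω i hi).symm⟩
      rw [this, Measure.restrict_univ]
    · intro v v' hv
      rw [Function.onFun, Set.disjoint_left]
      intro ω h1 h2
      apply hv
      funext j
      have a1 := h1 j (by omega)
      have a2 := h2 j (by omega)
      rw [a1] at a2
      have hj := j.2
      simpa only [extw, hj, dif_pos] using a2
  rw [part, part]
  congr 1
  funext v
  set γ := extw s v
  have e1 : ∫⁻ ω in cyl γ s, g ω * f (th s ω) ∂μ = ∫⁻ ω in cyl γ s, g γ * f (th s ω) ∂μ :=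
    setLIntegral_congr_fun (measurableSet_cyl _ _) fun ω hω => by
      rw [hg ω γ hω]
  have e2 : ∫⁻ ω in cyl γ s, g ω * (∫⁻ ω', f ω' ∂(nu μ (ω s))) ∂μ =
      ∫⁻ ω in cyl γ s, g γ * (∫⁻ ω', f ω' ∂(nu μ (γ s))) ∂μ :=
    setLIntegral_congr_fun (measurableSet_cyl _ _) fun ω hω => by
      rw [hg ω γ hω, hω s le_rfl]
  rw [e1, e2, lintegral_const_mul (g γ) (f := fun ω => f (th s ω)) (hf.comp (measurable_th s)), lintegral_const,
    Measure.restrict_apply_univ, ← lintegral_map hf (measurable_th s), restr_map hd h,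
    lintegral_smul_measure]
  rw [smul_eq_mul, mul_assoc, mul_comm (∫⁻ _, _ ∂_)]

lemma nu_nu (μ : Measure (ℕ → V d)) (x y : V d) : nu (nu μ x) y = nu μ (x + y) := by
  unfold nu
  rw [Measure.map_map (measurable_tr y) (measurable_tr x)]
  congr 1
  funext ω j
  simp [add_assoc]

lemma markov (hd : 3 ≤ d) {μ : Measure (ℕ → V d)} (h : IsSRWLaw μ 0) (x : V d) (s : ℕ)
    (g f : (ℕ → V d) → ℝ≥0∞) (hg : Adapted s g) (hf : Measurable f) :
    ∫⁻ ω, g ω * f (th s ω) ∂(nu μ x) = ∫⁻ ω, g ω * (∫⁻ ω', f ω' ∂(nu μ (ω s))) ∂(nu μ x) := by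
  have hmeas : Measurable fun ω : ℕ → V d => (∫⁻ ω', f ω' ∂(nu μ (ω s))) :=
    (measurable_of_countable (fun y : V d => ∫⁻ ω', f ω' ∂(nu μ y))).comp (measurable_pi_apply s)
  conv_lhs => rw [nu]
  rw [lintegral_map (f := fun ω => g ω * f (th s ω)) (hg.measurable.mul (hf.comp (measurable_th s))) (measurable_tr x)]
  conv_rhs => rw [nu]
  rw [lintegral_map (f := fun ω => g ω * (∫⁻ ω', f ω' ∂(nu μ (ω s)))) (hg.measurable.mul hmeas) (measurable_tr x)]
  have := markov0 hd h s (fun ω => g (fun j => ω j + x)) (fun ω => f (fun j => ω j + x))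
    (fun ω ω' hh => hg _ _ fun i hi => by rw [hh i hi]) (hf.comp (measurable_tr x))
  refine Eq.trans this ?_
  congr 1
  funext ω
  congr 1
  rw [← lintegral_map hf (measurable_tr x)]
  change ∫⁻ a, f a ∂(nu (nu μ (ω s)) x) = _
  rw [nu_nu]

lemma nu_zero (μ : Measure (ℕ → V d)) : nu μ 0 = μ := by
  unfold nu
  simp only [add_zero]
  exact Measure.map_id

lemma nu_prob {μ : Measure (ℕ → V d)} (h : IsSRWLaw μ 0) (x : V d) : IsProbabilityMeasure (nu μ x) := by
  have := h.1
  exact Measure.isProbabilityMeasure_map (measurable_tr x).aemeasurable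

lemma nu_ae (hd : 3 ≤ d) {μ : Measure (ℕ → V d)} (h : IsSRWLaw μ 0) (x : V d) :
    ∀ᵐ ω ∂(nu μ x), ω 0 = x ∧ ∀ i, adj (ω i) (ω (i + 1)) := by
  have hm : MeasurableSet {ω : ℕ → V d | ω 0 = x ∧ ∀ i, adj (ω i) (ω (i + 1))} := by
    have h1 : MeasurableSet {ω : ℕ → V d | ω 0 = x} :=
      Adapted.measurableSet (s := 0) fun ω ω' hh => by
        simp only [Set.mem_ofPred_eq]; rw [hh 0 le_rfl]
    have h2 : MeasurableSet {ω : ℕ → V d | ∀ i, adj (ω i) (ω (i + 1))} := by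
      have : {ω : ℕ → V d | ∀ i, adj (ω i) (ω (i + 1))} = ⋂ i, {ω | adj (ω i) (ω (i + 1))} := by
        ext; simp
      rw [this]
      exact MeasurableSet.iInter fun i => Adapted.measurableSet (s := i + 1) fun ω ω' hh => by
        simp only [Set.mem_ofPred_eq]; rw [hh i (by omega), hh (i + 1) (by omega)]
    exact h1.inter h2
  unfold nu
  rw [ae_map_iff (measurable_tr x).aemeasurable hm]
  filter_upwards [h.ae_nn hd] with ω hω
  refine ⟨by rw [hω.1, zero_add], fun i => ?_⟩
  have := hω.2 i
  rw [← adj_sub _ _ x]; simpa using this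

lemma nu_one (hd : 3 ≤ d) {μ : Measure (ℕ → V d)} (h : IsSRWLaw μ 0) (x : V d) (Φ : V d → ℝ≥0∞) :
    ∫⁻ ω, Φ (ω 1) ∂(nu μ x) = ∑ e : Fin d × Bool, (2 * (d : ℝ≥0∞))⁻¹ * Φ (x + stp e) := by
  have hms : ∀ y : V d, MeasurableSet {ω : ℕ → V d | ω 1 = y} := fun y =>
    Adapted.measurableSet (s := 1) fun ω ω' hh => by
        simp only [Set.mem_ofPred_eq]; rw [hh 1 le_rfl]
  have h1 : ∫⁻ ω, Φ (ω 1) ∂(nu μ x) =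
      ∫⁻ ω, ∑ e : Fin d × Bool, {ω : ℕ → V d | ω 1 = x + stp e}.indicator (fun _ => Φ (x + stp e)) ω ∂(nu μ x) := by
    apply lintegral_congr_ae
    filter_upwards [nu_ae hd h x] with ω hω
    obtain ⟨e, he⟩ := (adj_iff _ _).1 (hω.2 0)
    rw [hω.1, zero_add] at he
    rw [Finset.sum_eq_single e]
    · rw [Set.indicator_of_mem (show ω ∈ {ω : ℕ → V d | ω 1 = x + stp e} from he), he]
    · intro e' _ hne
      rw [Set.indicator_of_notMem]
      intro hc
      exact hne (stp_inj (add_left_cancel ((he.symm.trans hc).symm)))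
    · simp
  rw [h1, lintegral_finsetSum _ fun e _ => measurable_const.indicator (hms _)]
  apply Finset.sum_congr rfl
  intro e _
  rw [lintegral_indicator_const (hms _), mul_comm]
  congr 1
  let γ : ℕ → V d := fun i => if i = 0 then x else x + stp e
  have : nu μ x (cyl γ 1) = (2 * (d : ℝ≥0∞))⁻¹ := by
    rw [nu_cyl, h.cyl_val hd, if_pos, pow_one]
    refine ⟨by simp [γ], fun i hi => ?_⟩
    have : i = 0 := by omega
    subst this
    rw [adj_sub, adj_iff]
    exact ⟨e, by simp [γ]⟩
  rw [← this]
  apply measure_congr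
  filter_upwards [nu_ae hd h x] with ω hω
  apply propext
  constructor
  · intro h1 i hi
    interval_cases i
    · simpa [γ] using hω.1
    · have h1' : ω 1 = x + stp e := h1
      simpa [γ] using h1'
  · intro h1
    have := h1 1 le_rfl
    change ω 1 = x + stp e
    simpa [γ] using this

lemma first_step (hd : 3 ≤ d) {μ : Measure (ℕ → V d)} (h : IsSRWLaw μ 0) (x : V d)
    (f : (ℕ → V d) → ℝ≥0∞) (hf : Measurable f) :
    ∫⁻ ω, f (th 1 ω) ∂(nu μ x) = ∑ e : Fin d × Bool, (2 * (d : ℝ≥0∞))⁻¹ * ∫⁻ ω, f ω ∂(nu μ (x + stp e)) := by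
  have := markov hd h x 1 (fun _ => 1) f (fun _ _ _ => rfl) hf
  simp only [one_mul] at this
  rw [this, nu_one hd h x (fun y => ∫⁻ ω, f ω ∂(nu μ y))]

lemma sum_stp (f : V d → ℝ) (x : V d) : ∑ e : Fin d × Bool, f (x + stp e) = Lap f x + 2 * d * f x := by
  rw [Fintype.sum_prod_type]
  unfold Lap
  simp only [Fintype.sum_bool, stp, if_true]
  rw [Finset.sum_sub_distrib]
  simp [sub_eq_add_neg]
  ring

lemma measurableSet_at (t : ℕ) (B : Set (V d)) : MeasurableSet {ω : ℕ → V d | ω t ∈ B} :=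
  Adapted.measurableSet (s := t) fun ω ω' hh => by
        simp only [Set.mem_ofPred_eq]; rw [hh t le_rfl]

lemma occ_bound (hd : 3 ≤ d) : ∃ C : ℝ, 0 < C ∧ ∀ (μ : Measure (ℕ → V d)), IsSRWLaw μ 0 →
    ∀ (c : V d) (m : ℕ), 1 ≤ m → ∀ x, ∑' t : ℕ, nu μ x {ω | ω t ∈ cube c m} ≤ ENNReal.ofReal (C * (m : ℝ) ^ 2) := by
  obtain ⟨C, hC, H⟩ := occ hd
  refine ⟨C, hC, fun μ h c m hm x => ?_⟩
  obtain ⟨f, hf, hL⟩ := H c m hm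
  have hdpos : (0 : ℝ) < 2 * d := by
    have : (3 : ℝ) ≤ d := by exact_mod_cast hd
    linarith
  refine le_trans ?_ (ENNReal.ofReal_le_ofReal (hf x).2)
  rw [ENNReal.tsum_eq_iSup_nat]
  apply iSup_le
  intro T
  induction T generalizing x with
  | zero => simp
  | succ T ih =>
    rw [Finset.sum_range_succ']
    have h0 : nu μ x {ω | ω 0 ∈ cube c m} ≤ ENNReal.ofReal (if x ∈ cube c m then 1 else 0) := by
      have := nu_prob h x
      split_ifs with hx
      · simp; exact prob_le_one
      · simp
        refine measure_mono_null (t := {ω : ℕ → V d | ¬ (ω 0 = x ∧ ∀ i, adj (ω i) (ω (i + 1)))}) ?_ (nu_ae hd h x)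
        intro ω hω hc
        apply hx
        rw [← hc.1]; exact hω
    have h1 : ∀ t, nu μ x {ω | ω (t + 1) ∈ cube c m} =
        ∑ e : Fin d × Bool, (2 * (d : ℝ≥0∞))⁻¹ * nu μ (x + stp e) {ω | ω t ∈ cube c m} := by
      intro t
      have := first_step hd h x ({ω : ℕ → V d | ω t ∈ cube c m}.indicator 1)
        (measurable_one.indicator (measurableSet_at t _))
      simp only [lintegral_indicator_one (measurableSet_at t (cube c m))] at this
      rw [← this, ← lintegral_indicator_one (measurableSet_at (t + 1) _)]
      congr 1
      funext ω
      simp only [Set.indicator, Set.mem_ofPred_eq, th, add_comm 1 t]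
      rfl
    simp only [h1]
    rw [Finset.sum_comm]
    simp only [← Finset.mul_sum]
    have h2 : (∑ e : Fin d × Bool, ∑ t ∈ Finset.range T, nu μ (x + stp e) {ω | ω t ∈ cube c m})
        ≤ ENNReal.ofReal (∑ e : Fin d × Bool, f (x + stp e)) := by
      rw [ENNReal.ofReal_sum_of_nonneg fun e _ => (hf _).1]
      exact Finset.sum_le_sum fun e _ => ih _
    have hp : (2 * (d : ℝ≥0∞))⁻¹ = ENNReal.ofReal ((2 * (d : ℝ))⁻¹) := by
      rw [ENNReal.ofReal_inv_of_pos hdpos, ENNReal.ofReal_mul (by norm_num)]; simp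
    calc _ ≤ (2 * (d : ℝ≥0∞))⁻¹ * ENNReal.ofReal (∑ e : Fin d × Bool, f (x + stp e))
          + ENNReal.ofReal (if x ∈ cube c m then 1 else 0) := by gcongr
      _ = ENNReal.ofReal ((2 * (d : ℝ))⁻¹ * (∑ e : Fin d × Bool, f (x + stp e)) + (if x ∈ cube c m then 1 else 0)) := by
        rw [hp, ← ENNReal.ofReal_mul (by positivity), ← ENNReal.ofReal_add]
        · exact mul_nonneg (by positivity) (Finset.sum_nonneg fun e _ => (hf _).1)
        · split_ifs <;> norm_num
      _ ≤ ENNReal.ofReal (f x) := by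
        apply ENNReal.ofReal_le_ofReal
        rw [sum_stp]
        have := hL x
        rw [← mul_le_mul_iff_right₀ hdpos]
        rw [mul_add, mul_inv_cancel_left₀ hdpos.ne']
        split_ifs at this ⊢ <;> linarith

lemma transient (hd : 3 ≤ d) {μ : Measure (ℕ → V d)} (h : IsSRWLaw μ 0) :
    ∀ᵐ ω ∂μ, ∀ p : V d, {j | ω j = p}.Finite := by
  obtain ⟨C, hC, H⟩ := occ_bound hd
  rw [ae_all_iff]
  intro p
  have := H μ h p 1 le_rfl 0
  rw [nu_zero] at this
  have := ae_finite_setOfPred_mem (μ := μ) (s := fun t => {ω : ℕ → V d | ω t ∈ cube p 1})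
    (ne_top_of_le_ne_top ENNReal.ofReal_ne_top this)
  filter_upwards [this] with ω hω
  refine hω.subset fun j hj => ?_
  change ω j ∈ cube p 1
  rw [show ω j = p from hj]
  intro i; simp

/-- alive -/
def alive (D : Set (V d)) (t : ℕ) (ω : ℕ → V d) : Prop := ∀ i < t, ω i ∈ D

/-- avoid `a` up to exit -/
def av (D a : Set (V d)) : Set (ℕ → V d) := {ω | ∀ j, alive D j ω → ω j ∉ a}

lemma alive_adapted (D : Set (V d)) (t : ℕ) : Adapted t (alive D t) := by
  intro ω ω' hh
  simp only [alive, eq_iff_iff]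
  exact forall₂_congr fun i hi => by rw [hh i hi.le]

lemma measurableSet_av (D a : Set (V d)) : MeasurableSet (av D a) := by
  have : av D a = ⋂ j, {ω | alive D j ω → ω j ∉ a} := by ext; simp [av]
  rw [this]
  exact MeasurableSet.iInter fun j => Adapted.measurableSet (s := j) fun ω ω' hh => by
    simp only [Set.mem_ofPred_eq]; rw [hh j le_rfl, alive_adapted D j ω ω' hh]

lemma alive_add (D : Set (V d)) (s t : ℕ) (ω : ℕ → V d) :
    alive D (s + t) ω ↔ alive D s ω ∧ alive D t (th s ω) := by
  constructor
  · intro h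
    exact ⟨fun i hi => h i (by omega), fun i hi => h (s + i) (by omega)⟩
  · rintro ⟨h1, h2⟩ i hi
    by_cases his : i < s
    · exact h1 i his
    · obtain ⟨k, rfl⟩ := Nat.exists_eq_add_of_le (le_of_not_gt his)
      exact h2 k (by omega)

lemma av_th {D a : Set (V d)} {s : ℕ} {ω : ℕ → V d} (h : ω ∈ av D a) (hs : alive D s ω) :
    th s ω ∈ av D a := fun j hj => h (s + j) ((alive_add D s j ω).2 ⟨hs, hj⟩)

lemma harm (hd : 3 ≤ d) {μ : Measure (ℕ → V d)} (h : IsSRWLaw μ 0) (D a : Set (V d)) (x : V d)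
    (hx : x ∈ D) (hxa : x ∉ a) : Lap (fun y => (nu μ y (av D a)).toReal) x = 0 := by
  have hdpos : (0 : ℝ) < 2 * d := by
    have : (3 : ℝ) ≤ d := by exact_mod_cast hd
    linarith
  have h1 := first_step hd h x ((av D a).indicator 1) (measurable_one.indicator (measurableSet_av D a))
  simp only [lintegral_indicator_one (measurableSet_av D a)] at h1
  have h2 : ∫⁻ ω, (av D a).indicator 1 (th 1 ω) ∂(nu μ x) = nu μ x (av D a) := by
    rw [← lintegral_indicator_one (measurableSet_av D a)]
    apply lintegral_congr_ae
    filter_upwards [nu_ae hd h x] with ω hω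
    have : th 1 ω ∈ av D a ↔ ω ∈ av D a := by
      constructor
      · intro h j hj
        cases j with
        | zero => rw [hω.1]; exact hxa
        | succ j =>
          rw [add_comm] at hj ⊢
          exact h j ((alive_add D 1 j ω).1 hj).2
      · intro h
        refine av_th h ?_
        intro i hi
        have : i = 0 := by omega
        subst this
        rw [hω.1]; exact hx
    simp only [Set.indicator, this]
    rfl
  rw [h2] at h1
  have h3 : (nu μ x (av D a)).toReal = ∑ e : Fin d × Bool, (2 * (d : ℝ))⁻¹ * (nu μ (x + stp e) (av D a)).toReal := by
    rw [h1, ENNReal.toReal_sum]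
    · simp
    · intro e _
      have := nu_prob h (x + stp e)
      exact ENNReal.mul_ne_top (ENNReal.inv_ne_top.2 (two_d_ne hd)) (measure_ne_top _ _)
  rw [← Finset.mul_sum, sum_stp (fun y => (nu μ y (av D a)).toReal)] at h3
  field_simp at h3
  linarith

/-- indicator of alive visit -/
noncomputable def X (D A : Set (V d)) (t : ℕ) (ω : ℕ → V d) : ℝ≥0∞ :=
  if alive D t ω ∧ ω t ∈ A then 1 else 0

/-- number of alive visits -/
noncomputable def NN (D A : Set (V d)) (ω : ℕ → V d) : ℝ≥0∞ := ∑' t, X D A t ω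

lemma X_adapted (D A : Set (V d)) (t : ℕ) : Adapted t (X D A t) := by
  intro ω ω' hh
  simp only [X]
  rw [alive_adapted D t ω ω' hh, hh t le_rfl]

lemma measurable_NN (D A : Set (V d)) : Measurable (NN D A) :=
  Measurable.tsum fun t => (X_adapted D A t).measurable

lemma X_add_le (D A : Set (V d)) (s t : ℕ) (ω : ℕ → V d) : X D A (s + t) ω ≤ X D A t (th s ω) := by
  unfold X
  by_cases h : alive D (s + t) ω ∧ ω (s + t) ∈ A
  · rw [if_pos h, if_pos]
    exact ⟨((alive_add D s t ω).1 h.1).2, h.2⟩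
  · rw [if_neg h]; exact zero_le

lemma sq_tsum_le (x : ℕ → ℝ≥0∞) : (∑' t, x t) ^ 2 ≤ 2 * ∑' s, x s * ∑' u, x (s + u) := by
  have e : ∀ s, x s * ∑' u, x (s + u) = ∑' t, (if s ≤ t then x s * x t else 0) := by
    intro s
    rw [← ENNReal.tsum_mul_left]
    have := (add_right_injective s).tsum_eq (f := fun t => if s ≤ t then x s * x t else 0) (by
      intro t ht
      simp only [Function.mem_support] at ht
      have : s ≤ t := by
        by_contra hc
        simp [hc] at ht
      exact ⟨t - s, by simp only; omega⟩)
    rw [← this]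
    simp
  simp only [e]
  have h2 : (∑' t, x t) ^ 2 = ∑' s, ∑' t, x s * x t := by
    rw [sq, ← ENNReal.tsum_mul_right]
    simp only [ENNReal.tsum_mul_left]
  rw [h2, two_mul]
  nth_rewrite 3 [ENNReal.tsum_comm]
  rw [← ENNReal.tsum_add]
  refine ENNReal.tsum_le_tsum fun s => ?_
  rw [← ENNReal.tsum_add]
  refine ENNReal.tsum_le_tsum fun t => ?_
  rcases le_total s t with h | h
  · rw [if_pos h]; exact le_self_add
  · rw [if_pos h, mul_comm]; exact le_add_self

lemma moments (hd : 3 ≤ d) : ∃ K : ℝ, 0 < K ∧ ∀ (D a : Set (V d)) (x1 : V d) (m : ℕ), 200 * d ≤ m →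
    cube x1 (m / 2 - 1) ⊆ D \ a → ∀ μ : Measure (ℕ → V d), IsSRWLaw μ 0 → ∀ z ∈ cube x1 (m / 4),
    (∫⁻ ω, NN D (cube x1 (m / 4)) ω * (av D a).indicator 1 ω ∂(nu μ z)
      ≤ ENNReal.ofReal (K * (m : ℝ) ^ 2) * nu μ z (av D a)) ∧
    (∫⁻ ω, NN D (cube x1 (m / 4)) ω ^ 2 * (av D a).indicator 1 ω ∂(nu μ z)
      ≤ ENNReal.ofReal (K * (m : ℝ) ^ 4) * nu μ z (av D a)) := by
  obtain ⟨C, hC, HC⟩ := occ_bound hd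
  obtain ⟨CH, hCH, HH⟩ := harnack (d := d) (by omega)
  refine ⟨C * CH + 2 * C ^ 2 * CH, by positivity, ?_⟩
  intro D a x1 m hm hcube μ h z hz
  set A := cube x1 (m / 4) with hA
  set b := ENNReal.ofReal (C * (m : ℝ) ^ 2) with hb
  have hprob := fun y => nu_prob h y
  set hmax := ENNReal.ofReal CH * nu μ z (av D a) with hhmax
  have hle : ∀ w ∈ A, nu μ w (av D a) ≤ hmax := by
    intro w hw
    have := HH x1 m hm (fun y => (nu μ y (av D a)).toReal) (fun _ => ENNReal.toReal_nonneg)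
      (fun y hy => harm hd h D a y (hcube hy).1 (hcube hy).2) z hz w hw
    rw [← ENNReal.ofReal_toReal (measure_ne_top (nu μ w) (av D a)), hhmax,
      ← ENNReal.ofReal_toReal (measure_ne_top (nu μ z) (av D a)), ← ENNReal.ofReal_mul hCH.le]
    exact ENNReal.ofReal_le_ofReal this
  have hocc : ∀ w, ∑' t, ∫⁻ ω, X D A t ω ∂(nu μ w) ≤ b := by
    intro w
    refine le_trans ?_ (HC μ h x1 m (by omega) w)
    refine ENNReal.tsum_le_tsum fun t => ?_
    rw [← lintegral_indicator_one (measurableSet_at t _)]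
    refine lintegral_mono fun ω => ?_
    unfold X
    by_cases hc : alive D t ω ∧ ω t ∈ A
    · rw [if_pos hc, Set.indicator_of_mem]
      · rfl
      · change ω t ∈ cube x1 m
        exact cube_mono (by omega) hc.2
    · rw [if_neg hc]; exact zero_le
  -- general step
  have gen : ∀ (G : (ℕ → V d) → ℝ≥0∞), Measurable G → ∀ B : ℝ≥0∞, (∀ w ∈ A, ∫⁻ ω, G ω ∂(nu μ w) ≤ B) →
      ∀ w, ∫⁻ ω, ∑' t, X D A t ω * G (th t ω) ∂(nu μ w) ≤ b * B := by
    intro G hG B hB w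
    rw [lintegral_tsum (f := fun t ω => X D A t ω * G (th t ω)) fun t => ((X_adapted D A t).measurable.mul (hG.comp (measurable_th t))).aemeasurable]
    calc _ ≤ ∑' t, (∫⁻ ω, X D A t ω ∂(nu μ w)) * B := by
          refine ENNReal.tsum_le_tsum fun t => ?_
          rw [markov hd h w t _ _ (X_adapted D A t) hG, ← lintegral_mul_const _ (X_adapted D A t).measurable]
          refine lintegral_mono fun ω => ?_
          simp only [X]
          split_ifs with hc
          · rw [one_mul, one_mul]; exact hB _ hc.2
          · simp
      _ = (∑' t, (∫⁻ ω, X D A t ω ∂(nu μ w))) * B := ENNReal.tsum_mul_right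
      _ ≤ b * B := by gcongr; exact hocc w
  have hN : Measurable (NN D A) := measurable_NN D A
  have hI : Measurable ((av D a).indicator (1 : (ℕ → V d) → ℝ≥0∞)) := measurable_one.indicator (measurableSet_av D a)
  have F1 : ∀ w, ∫⁻ ω, NN D A ω * (av D a).indicator 1 ω ∂(nu μ w) ≤ b * hmax := by
    intro w
    refine le_trans (lintegral_mono fun ω => ?_) (gen ((av D a).indicator 1) hI hmax
      (fun w hw => by rw [lintegral_indicator_one (measurableSet_av D a)]; exact hle w hw) w)
    simp only [NN]
    rw [← ENNReal.tsum_mul_right]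
    refine ENNReal.tsum_le_tsum fun t => ?_
    by_cases hc : alive D t ω ∧ ω t ∈ A
    · by_cases hω : ω ∈ av D a
      · rw [Set.indicator_of_mem hω, Set.indicator_of_mem (av_th hω hc.1)]; simp
      · rw [Set.indicator_of_notMem hω, mul_zero]; exact zero_le
    · simp [X, hc]
  have F2 : ∫⁻ ω, NN D A ω ^ 2 * (av D a).indicator 1 ω ∂(nu μ z) ≤ 2 * (b * (b * hmax)) := by
    have := gen (fun ω => NN D A ω * (av D a).indicator 1 ω) (hN.mul hI) (b * hmax) (fun w _ => F1 w) z
    refine le_trans ?_ (mul_le_mul_right this 2)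
    rw [← lintegral_const_mul' _ _ (by norm_num)]
    refine lintegral_mono fun ω => ?_
    by_cases hω : ω ∈ av D a
    · rw [Set.indicator_of_mem hω]
      simp only [Pi.one_apply, mul_one]
      refine (sq_tsum_le _).trans ?_
      refine mul_le_mul_right ?_ 2
      refine ENNReal.tsum_le_tsum fun s => ?_
      by_cases hc : alive D s ω ∧ ω s ∈ A
      · rw [Set.indicator_of_mem (av_th hω hc.1)]
        simp only [Pi.one_apply, mul_one]
        gcongr
        exact ENNReal.tsum_le_tsum fun u => X_add_le D A s u ω
      · simp [X, hc]
    · simp [hω]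
  constructor
  · refine (F1 z).trans ?_
    rw [hhmax, ← mul_assoc, hb, ← ENNReal.ofReal_mul (by positivity)]
    refine mul_le_mul_left (ENNReal.ofReal_le_ofReal ?_) _
    nlinarith [show 0 ≤ 2 * C ^ 2 * CH * (m : ℝ) ^ 2 by positivity]
  · refine F2.trans ?_
    have e2 : (2 : ℝ≥0∞) = ENNReal.ofReal 2 := by simp
    have e3 : 2 * (b * (b * hmax)) = ENNReal.ofReal (2 * (C * (m : ℝ) ^ 2 * (C * (m : ℝ) ^ 2 * CH))) * nu μ z (av D a) := by
      rw [ENNReal.ofReal_mul (by norm_num), ENNReal.ofReal_mul (p := C * (m : ℝ) ^ 2) (by positivity),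
        ENNReal.ofReal_mul (p := C * (m : ℝ) ^ 2) (by positivity),
        ← e2, ← hb, hhmax]
      ring
    rw [e3]
    refine mul_le_mul_left (ENNReal.ofReal_le_ofReal ?_) _
    nlinarith [show 0 ≤ C * CH * (m : ℝ) ^ 4 by positivity]

lemma alive_iff_le (D : Set (V d)) (ω : ℕ → V d) (j : ℕ) : alive D j ω ↔ (j : ENat) ≤ exitTimeE D ω := by
  unfold exitTimeE
  split_ifs with h
  · rw [Nat.cast_le, Nat.le_find_iff]
    simp [alive]
  · push Not at h
    simp [alive, h]

lemma stop_alive {D : Set (V d)} {ω : ℕ → V d} {j : ℕ} (h : alive D j ω) : stopAt D ω j = ω j := by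
  unfold stopAt
  rw [if_pos ((alive_iff_le D ω j).1 h)]

lemma stop_not {D : Set (V d)} {ω : ℕ → V d} {j : ℕ} (h : ¬ alive D j ω) : stopAt D ω j ∉ D := by
  unfold stopAt
  rw [if_neg (fun hc => h ((alive_iff_le D ω j).2 hc))]
  have hex : ∃ j, ω j ∉ D := by
    simp only [alive] at h
    push Not at h
    obtain ⟨i, _, hi⟩ := h
    exact ⟨i, hi⟩
  unfold exitTime exitTimeE
  rw [dif_pos hex, ENat.toNat_natCast]
  exact Nat.find_spec hex

lemma alive_of_stop {D : Set (V d)} {ω : ℕ → V d} {j : ℕ} (h : stopAt D ω j ∈ D) : alive D (j + 1) ω := by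
  have h1 : alive D j ω := by
    by_contra hc
    exact stop_not hc h
  rw [stop_alive h1] at h
  intro i hi
  rcases Nat.lt_succ_iff_lt_or_eq.1 hi with hi | rfl
  · exact h1 i hi
  · exact h

lemma alive_mono {D : Set (V d)} {ω : ℕ → V d} {i j : ℕ} (hij : i ≤ j) (h : alive D j ω) : alive D i ω :=
  fun k hk => h k (by omega)

/-- good paths -/
def good (ω : ℕ → V d) : Prop :=
  ω 0 = 0 ∧ (∀ i, adj (ω i) (ω (i + 1))) ∧ ∀ p : V d, {j | ω j = p}.Finite

/-- stopped path properties -/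
structure SP (D : Set (V d)) (s : ℕ → V d) : Prop where
  zero : s 0 = 0
  adj : ∀ j, s j ∈ D → adj (s j) (s (j + 1))
  fin : ∀ p ∈ D, {j | s j = p}.Finite

lemma good.sp {ω : ℕ → V d} (h : good ω) (D : Set (V d)) : SP D (stopAt D ω) where
  zero := by rw [stop_alive (by intro i hi; omega)]; exact h.1
  adj := by
    intro j hj
    have := alive_of_stop hj
    rw [stop_alive this, stop_alive (alive_mono (by omega) this)]
    exact h.2.1 j
  fin := by
    intro p hp
    refine (h.2.2 p).subset fun j hj => ?_
    have hj' : stopAt D ω j = p := hj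
    have := alive_of_stop (hj'.symm ▸ hp : stopAt D ω j ∈ D)
    rw [stop_alive (alive_mono (by omega) this)] at hj'
    exact hj'

lemma lastVisit_eq {s : ℕ → V d} {t r : ℕ} (h1 : t ≤ r) (h2 : s r = s t) (h3 : ∀ j > r, s j ≠ s t) :
    lastVisit s t = r := by
  unfold lastVisit
  have : IsGreatest {j | t ≤ j ∧ s j = s t} r := by
    refine ⟨⟨h1, h2⟩, fun j hj => ?_⟩
    by_contra hc
    exact h3 j (by omega) hj.2
  exact this.csSup_eq

lemma SP.lastVisit_spec {D : Set (V d)} {s : ℕ → V d} (h : SP D s) {t : ℕ} (ht : s t ∈ D) :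
    t ≤ lastVisit s t ∧ s (lastVisit s t) = s t ∧ ∀ j > lastVisit s t, s j ≠ s t := by
  have hfin : {j | t ≤ j ∧ s j = s t}.Finite := (h.fin _ ht).subset fun j hj => hj.2
  have hne : {j | t ≤ j ∧ s j = s t}.Nonempty := ⟨t, le_rfl, rfl⟩
  have hmem := Nat.sSup_mem hne hfin.bddAbove
  refine ⟨hmem.1, hmem.2, fun j hj hc => ?_⟩
  have : j ≤ lastVisit s t := le_csSup hfin.bddAbove ⟨by have := hmem.1; unfold lastVisit at hj; omega, hc⟩
  omega

/-- proper index -/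
def proper (D : Set (V d)) (s : ℕ → V d) (k : ℕ) : Prop :=
  s (leTime s k) ∈ D ∧ ∀ j > leTime s k, s j ≠ s (leTime s k)

lemma SP.proper_zero {D : Set (V d)} {s : ℕ → V d} (h : SP D s) (h0 : (0 : V d) ∈ D) :
    proper D s 0 ∧ infLoopErase s 0 = 0 := by
  have := h.lastVisit_spec (t := 0) (by rw [h.zero]; exact h0)
  rw [h.zero] at this
  unfold proper infLoopErase
  rw [leTime]
  rw [this.2.1]
  exact ⟨⟨h0, this.2.2⟩, rfl⟩

lemma SP.step {D : Set (V d)} {s : ℕ → V d} (h : SP D s) {k : ℕ} (hk : proper D s k)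
    (hn : ∀ y, USFPaper.adj (infLoopErase s k) y → y ∈ D) :
    proper D s (k + 1) ∧ leTime s k < leTime s (k + 1) ∧
      USFPaper.adj (infLoopErase s k) (infLoopErase s (k + 1)) := by
  have ha := h.adj _ hk.1
  have := h.lastVisit_spec (t := leTime s k + 1) (hn _ ha)
  have e : leTime s (k + 1) = lastVisit s (leTime s k + 1) := rfl
  rw [← e] at this
  refine ⟨⟨?_, ?_⟩, by omega, ?_⟩
  · rw [this.2.1]; exact hn _ ha
  · rw [this.2.1]; exact this.2.2
  · unfold infLoopErase; rw [this.2.1]; exact ha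

lemma SP.run {D : Set (V d)} {s : ℕ → V d} (h : SP D s) {W : Set (V d)} (hW : W ⊆ D) {k0 k : ℕ}
    (hk0 : proper D s k0) (hL : infLoopErase s k0 ∈ W)
    (hi : ∀ i, k0 ≤ i → i < k → infLoopErase s i ∉ innerBdry W) :
    (∀ i, k0 ≤ i → i ≤ k → proper D s i ∧ infLoopErase s i ∈ W) ∧
    (∀ i, k0 ≤ i → i < k → leTime s i < leTime s (i + 1)) := by
  have key : ∀ i, k0 ≤ i → i < k → proper D s i → infLoopErase s i ∈ W →
      proper D s (i + 1) ∧ leTime s i < leTime s (i + 1) ∧ infLoopErase s (i + 1) ∈ W := by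
    intro i h1 h2 h3 h4
    have hnb : ∀ y, USFPaper.adj (infLoopErase s i) y → y ∈ W := by
      intro y hy
      by_contra hc
      exact hi i h1 h2 ⟨h4, y, hy, hc⟩
    obtain ⟨a1, a2, a3⟩ := h.step h3 (fun y hy => hW (hnb y hy))
    exact ⟨a1, a2, hnb _ a3⟩
  have main : ∀ i, k0 ≤ i → i ≤ k → proper D s i ∧ infLoopErase s i ∈ W := by
    intro i h1
    induction i, h1 using Nat.le_induction with
    | base => exact fun _ => ⟨hk0, hL⟩
    | succ i h1 ih =>
      intro h2
      obtain ⟨a1, a2⟩ := ih (by omega)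
      obtain ⟨b1, _, b3⟩ := key i h1 (by omega) a1 a2
      exact ⟨b1, b3⟩
  exact ⟨main, fun i h1 h2 => (key i h1 h2 (main i h1 h2.le).1 (main i h1 h2.le).2).2.1⟩

lemma mono_of_run {τ : ℕ → ℕ} {k0 k : ℕ} (h : ∀ i, k0 ≤ i → i < k → τ i < τ (i + 1)) :
    ∀ i j, k0 ≤ i → i < j → j ≤ k → τ i < τ j := by
  intro i j hi hij
  induction j, hij using Nat.le_induction with
  | base => exact fun hj => h i hi (by omega)
  | succ j hj ih => exact fun hjk => (ih (by omega)).trans (h j (by omega) (by omega))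

lemma inj_of_run {D : Set (V d)} {s : ℕ → V d} {k0 k : ℕ}
    (hp : ∀ i, k0 ≤ i → i ≤ k → proper D s i) (h : ∀ i, k0 ≤ i → i < k → leTime s i < leTime s (i + 1)) :
    ∀ i j, k0 ≤ i → i < j → j ≤ k → infLoopErase s i ≠ infLoopErase s j := by
  intro i j hi hij hjk
  have := (hp i hi (by omega)).2 _ (mono_of_run h i j hi hij hjk)
  exact this.symm

lemma SP.exists_hit {D : Set (V d)} {s : ℕ → V d} (h : SP D s) {n : ℕ} (hW : cube 0 n ⊆ D) :
    ∃ k, infLoopErase s k ∈ innerBdry (cube 0 n) := by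
  by_contra! hc
  have h00 : (0 : V d) ∈ cube 0 n := by simp [mem_cube0]
  have h0 := h.proper_zero (hW h00)
  have hr := fun k => h.run (k := k) hW h0.1 (by rw [h0.2]; exact h00) (fun i _ _ => hc i)
  have hinj : Function.Injective (infLoopErase s) := by
    intro i j hij
    by_contra hne
    rcases lt_or_gt_of_ne hne with hl | hl
    · exact inj_of_run (fun i h1 h2 => ((hr j).1 i h1 h2).1) (hr j).2 i j (by omega) hl le_rfl hij
    · exact inj_of_run (fun l h1 h2 => ((hr i).1 l h1 h2).1) (hr i).2 j i (by omega) hl le_rfl hij.symm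
  exact Set.infinite_of_injective_forall_mem hinj (fun k => ((hr k).1 k (by omega) le_rfl).2) (cube_finite 0 n)

lemma hitIdx_spec {B : Set (V d)} {γ : ℕ → V d} (h : ∃ j, γ j ∈ B) :
    γ (hitIdx B γ) ∈ B ∧ ∀ i < hitIdx B γ, γ i ∉ B := by
  unfold hitIdx hitTimeE
  rw [dif_pos h, ENat.toNat_natCast]
  exact ⟨Nat.find_spec h, fun i hi => Nat.find_min h hi⟩

lemma hitIdx_eq {B : Set (V d)} {γ : ℕ → V d} {k : ℕ} (h1 : γ k ∈ B) (h2 : ∀ i < k, γ i ∉ B) :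
    hitIdx B γ = k := by
  obtain ⟨a1, a2⟩ := hitIdx_spec ⟨k, h1⟩
  rcases lt_trichotomy (hitIdx B γ) k with h | h | h
  · exact absurd a1 (h2 _ h)
  · exact h
  · exact absurd h1 (a2 _ h)

lemma hitIdxFrom_spec (B : Set (V d)) (t : ℕ) (γ : ℕ → V d) :
    t ≤ hitIdxFrom B t γ ∧ ∀ i, t ≤ i → i < hitIdxFrom B t γ → γ i ∉ B := by
  unfold hitIdxFrom
  split_ifs with h
  · exact ⟨(Nat.find_spec h).1, fun i h1 h2 hc => Nat.find_min h h2 ⟨h1, hc⟩⟩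
  · exact ⟨le_rfl, fun i h1 h2 => by omega⟩

/-- index of the first hit -/
noncomputable def k1 (D : Set (V d)) (n : ℕ) (ω : ℕ → V d) : ℕ := hitIdx (innerBdry (cube 0 n)) (lerw D ω)

/-- time of the first hit -/
noncomputable def sg (D : Set (V d)) (n : ℕ) (ω : ℕ → V d) : ℕ := leTime (stopAt D ω) (k1 D n ω)

lemma alpha_facts {D : Set (V d)} {n : ℕ} (hW : cube 0 n ⊆ D) {ω : ℕ → V d} (h : good ω) :
    lerw D ω (k1 D n ω) ∈ innerBdry (cube 0 n) ∧
    (∀ i < k1 D n ω, lerw D ω i ∉ innerBdry (cube 0 n)) ∧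
    (∀ i ≤ k1 D n ω, proper D (stopAt D ω) i ∧ lerw D ω i ∈ cube 0 n) ∧
    (∀ i < k1 D n ω, leTime (stopAt D ω) i < leTime (stopAt D ω) (i + 1)) := by
  have hsp := h.sp D
  obtain ⟨a1, a2⟩ := hitIdx_spec (hsp.exists_hit hW)
  have h00 : (0 : V d) ∈ cube 0 n := by simp [mem_cube0]
  have h0 := hsp.proper_zero (hW h00)
  obtain ⟨r1, r2⟩ := hsp.run (k := k1 D n ω) hW h0.1 (by rw [h0.2]; exact h00) (fun i _ hi => a2 i hi)
  exact ⟨a1, a2, fun i hi => r1 i (by omega) hi, fun i hi => r2 i (by omega) hi⟩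

lemma mem_alpha {D : Set (V d)} {n : ℕ} {ω : ℕ → V d} {p : V d} :
    p ∈ alphaList D n ω ↔ ∃ i ≤ k1 D n ω, lerw D ω i = p := by
  simp [alphaList, k1, Nat.lt_succ_iff]

lemma endPt_alpha (D : Set (V d)) (n : ℕ) (ω : ℕ → V d) : endPt (alphaList D n ω) = lerw D ω (k1 D n ω) := by
  simp [endPt, alphaList, k1, List.range_succ]

lemma sg_mono {D : Set (V d)} {n : ℕ} (hW : cube 0 n ⊆ D) {ω : ℕ → V d} (h : good ω) {i : ℕ}
    (hi : i ≤ k1 D n ω) : leTime (stopAt D ω) i ≤ sg D n ω := by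
  rcases hi.lt_or_eq with hi | rfl
  · exact (mono_of_run (k0 := 0) (fun i _ h2 => (alpha_facts hW h).2.2.2 i h2) i _ (by omega) hi le_rfl).le
  · exact le_rfl

lemma alive_sg {D : Set (V d)} {n : ℕ} (hW : cube 0 n ⊆ D) {ω : ℕ → V d} (h : good ω) :
    alive D (sg D n ω) ω := by
  have := ((alpha_facts hW h).2.2.1 _ le_rfl).1.1
  exact alive_mono (by unfold sg; omega) (alive_of_stop this)

lemma avoid_after {D : Set (V d)} {n : ℕ} (hW : cube 0 n ⊆ D) {ω : ℕ → V d} (h : good ω) {t : ℕ}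
    (ht : sg D n ω < t) (hal : alive D t ω) : ω t ∉ alphaList D n ω := by
  intro hc
  obtain ⟨i, hi, he⟩ := mem_alpha.1 hc
  have := ((alpha_facts hW h).2.2.1 i hi).1.2 t (lt_of_le_of_lt (sg_mono hW h hi) ht)
  rw [stop_alive hal] at this
  exact this he.symm

lemma replacement {D : Set (V d)} {n : ℕ} (hW : cube 0 n ⊆ D) {ω ω' : ℕ → V d} (h : good ω') {T : ℕ}
    (hT : sg D n ω' ≤ T) (hag : ∀ i ≤ T, ω i = ω' i) (hal : alive D T ω')
    (hav : ∀ t > T, alive D t ω → ω t ∉ alphaList D n ω') :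
    alphaList D n ω = alphaList D n ω' ∧ sg D n ω = sg D n ω' := by
  obtain ⟨f1, f2, f3, f4⟩ := alpha_facts hW h
  have hal2 : ∀ j ≤ T, alive D j ω := fun j hj i hi => by
    rw [hag i (by omega)]; exact hal i (by omega)
  have hs : ∀ j ≤ T, stopAt D ω j = stopAt D ω' j := fun j hj => by
    rw [stop_alive (hal2 j hj), stop_alive (alive_mono hj hal), hag j hj]
  have core : ∀ k ≤ k1 D n ω', ∀ t, t ≤ T → lastVisit (stopAt D ω') t = leTime (stopAt D ω') k →
      t ≤ leTime (stopAt D ω') k → stopAt D ω' (leTime (stopAt D ω') k) = stopAt D ω' t →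
      lastVisit (stopAt D ω) t = leTime (stopAt D ω') k := by
    intro k hk t ht hlv htl heq
    have hle : leTime (stopAt D ω') k ≤ T := (sg_mono hW h hk).trans hT
    apply lastVisit_eq htl
    · rw [hs _ hle, hs _ ht, heq]
    · intro j hj
      rw [hs _ ht, ← heq]
      by_cases hjT : j ≤ T
      · rw [hs _ hjT]
        exact (f3 k hk).1.2 j hj
      · by_cases hja : alive D j ω
        · rw [stop_alive hja]
          intro hc
          exact hav j (by omega) hja (mem_alpha.2 ⟨k, hk, hc.symm⟩)
        · intro hc
          exact stop_not hja (hc ▸ (f3 k hk).1.1)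
  have hsp := h.sp D
  have h00 : (0 : V d) ∈ D := hW (by simp [mem_cube0])
  have main : ∀ k ≤ k1 D n ω', leTime (stopAt D ω) k = leTime (stopAt D ω') k := by
    intro k
    induction k with
    | zero =>
      intro hk
      have := hsp.lastVisit_spec (t := 0) (by rw [hsp.zero]; exact h00)
      exact core 0 hk 0 (by omega) rfl (by omega) this.2.1
    | succ k ih =>
      intro hk
      have e : leTime (stopAt D ω) (k + 1) = lastVisit (stopAt D ω) (leTime (stopAt D ω) k + 1) := rfl
      rw [e, ih (by omega)]
      have hlt := f4 k (by omega)
      have hle := (sg_mono hW h hk).trans hT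
      have hD : stopAt D ω' (leTime (stopAt D ω') k + 1) ∈ D := by
        by_contra hc
        -- after exiting, the stopped path stays outside
        have hna : alive D (leTime (stopAt D ω') k + 1) ω' := alive_mono (by omega) hal
        rw [stop_alive hna] at hc
        have := alive_of_stop (f3 (k + 1) hk).1.1
        exact hc (this _ (by omega))
      have := hsp.lastVisit_spec hD
      exact core (k + 1) hk _ (by omega) rfl (by omega) this.2.1
  have hL : ∀ k ≤ k1 D n ω', lerw D ω k = lerw D ω' k := by
    intro k hk
    change stopAt D ω (leTime (stopAt D ω) k) = stopAt D ω' (leTime (stopAt D ω') k)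
    rw [main k hk, hs _ ((sg_mono hW h hk).trans hT)]
  have hk : k1 D n ω = k1 D n ω' := by
    apply hitIdx_eq
    · rw [hL _ le_rfl]; exact f1
    · intro i hi
      rw [hL i hi.le]; exact f2 i hi
  constructor
  · unfold alphaList
    change List.map _ (List.range (k1 D n ω + 1)) = List.map _ (List.range (k1 D n ω' + 1))
    rw [hk]
    apply List.map_congr_left
    intro i hi
    exact hL i (by simpa [Nat.lt_succ_iff] using hi)
  · unfold sg
    rw [hk, main _ le_rfl]

lemma hitCount_range (A : Set (V d)) (f : ℕ → V d) (K : ℕ) :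
    hitCount A ((List.range K).map f) = ((Finset.range K).filter fun i => f i ∈ A).card := by
  unfold hitCount
  induction K with
  | zero => simp
  | succ K ih =>
    rw [List.range_succ, Finset.range_add_one, Finset.filter_insert]
    simp only [List.map_append, List.sum_append, ih]
    split_ifs with h
    · rw [Finset.card_insert_of_notMem (by simp)]; simp [h]
    · simp [h]

/-- structure of beta -/
lemma beta_facts {D : Set (V d)} {n m : ℕ} (hD : cube 0 (n + m) ⊆ D) {ω : ℕ → V d} (h : good ω) :
    ∃ k2, k1 D n ω ≤ k2 ∧ (∀ A, hitCount A (betaList D n m ω) =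
      ((Finset.range (k2 - k1 D n ω + 1)).filter fun i => lerw D ω (k1 D n ω + i) ∈ A).card) ∧
    (∀ i, k1 D n ω ≤ i → i ≤ k2 → proper D (stopAt D ω) i) ∧
    (∀ i, k1 D n ω ≤ i → i < k2 → leTime (stopAt D ω) i < leTime (stopAt D ω) (i + 1)) := by
  have hW : cube 0 n ⊆ D := (cube_mono (by omega)).trans hD
  obtain ⟨f1, f2, f3, f4⟩ := alpha_facts hW h
  set x0 := lerw D ω (k1 D n ω) with hx0
  have hs := hitIdxFrom_spec (innerBdry (cube x0 m)) (k1 D n ω) (lerw D ω)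
  obtain ⟨r1, r2⟩ := (h.sp D).run (W := cube x0 m) (k0 := k1 D n ω) ((cube_sub f1.1 le_rfl).trans hD) (f3 _ le_rfl).1 (self_mem_cube _ _) hs.2
  refine ⟨_, hs.1, fun A => ?_, fun i h1 h2 => (r1 i h1 h2).1, r2⟩
  exact hitCount_range A (fun i => lerw D ω (k1 D n ω + i)) _

lemma ae_good (hd : 3 ≤ d) {μ : Measure (ℕ → V d)} (h : IsSRWLaw μ 0) : ∀ᵐ ω ∂μ, good ω := by
  filter_upwards [h.ae_nn hd, transient hd h] with ω h1 h2
  exact ⟨h1.1, h1.2, h2⟩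

/-- the sets `C_j` -/
def Cset (D : Set (V d)) (n : ℕ) (a : List (V d)) (j : ℕ) : Set (ℕ → V d) :=
  {ω | ∃ ω', good ω' ∧ (∀ i ≤ j, ω i = ω' i) ∧ alphaList D n ω' = a ∧ sg D n ω' = j}

/-- measurable version of `α = a` -/
def Mset (D : Set (V d)) (n : ℕ) (a : List (V d)) : Set (ℕ → V d) :=
  ⋃ j, (Cset D n a j ∩ {ω | ∀ t > j, alive D t ω → ω t ∉ a})

lemma measurable_M (D : Set (V d)) (n : ℕ) (a : List (V d)) : MeasurableSet (Mset D n a) := by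
  refine MeasurableSet.iUnion fun j => MeasurableSet.inter ?_ ?_
  · refine Adapted.measurableSet (s := j) fun ω ω' hh => ?_
    simp only [Cset, Set.mem_ofPred_eq, eq_iff_iff]
    refine exists_congr fun ω'' => and_congr_right fun _ => and_congr_left fun _ => ?_
    exact forall₂_congr fun i hi => by rw [hh i hi]
  · have : {ω : ℕ → V d | ∀ t > j, alive D t ω → ω t ∉ a} = ⋂ t, {ω | t > j → alive D t ω → ω t ∉ a} := by
      ext; simp
    rw [this]
    exact MeasurableSet.iInter fun t => Adapted.measurableSet (s := t) fun ω ω' hh => by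
      simp only [Set.mem_ofPred_eq]; rw [hh t le_rfl, alive_adapted D t ω ω' hh]

lemma M_iff {D : Set (V d)} {n : ℕ} (hW : cube 0 n ⊆ D) (a : List (V d)) {ω : ℕ → V d} (h : good ω) :
    alphaList D n ω = a ↔ ω ∈ Mset D n a := by
  constructor
  · rintro rfl
    exact Set.mem_iUnion.2 ⟨sg D n ω, ⟨ω, h, fun _ _ => rfl, rfl, rfl⟩,
      fun t ht hal => avoid_after hW h ht hal⟩
  · intro hM
    obtain ⟨j, ⟨ω', h1, h2, h3, h4⟩, h5⟩ := Set.mem_iUnion.1 hM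
    rw [← h3]
    exact (replacement hW h1 (T := j) h4.le h2 (h4 ▸ alive_sg hW h1) (by rw [h3]; exact h5)).1

/-- the sets `B_T` -/
def Bset (D : Set (V d)) (n : ℕ) (a : List (V d)) (A : Set (V d)) (T : ℕ) : Set (ℕ → V d) :=
  {ω | ∃ ω', good ω' ∧ (∀ i ≤ T, ω i = ω' i) ∧ alphaList D n ω' = a ∧ sg D n ω' < T ∧ alive D T ω' ∧
    ω' T ∈ A ∧ ∀ t, sg D n ω' < t → t < T → ω' t ∉ A}

lemma B_adapted (D : Set (V d)) (n : ℕ) (a : List (V d)) (A : Set (V d)) (T : ℕ) :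
    Adapted T (· ∈ Bset D n a A T) := by
  intro ω ω' hh
  simp only [Bset, Set.mem_ofPred_eq, eq_iff_iff]
  refine exists_congr fun ω'' => and_congr_right fun _ => and_congr_left fun _ => ?_
  exact forall₂_congr fun i hi => by rw [hh i hi]

lemma B_repl {D : Set (V d)} {n : ℕ} (hW : cube 0 n ⊆ D) {a : List (V d)} {A : Set (V d)} {T : ℕ}
    {ω : ℕ → V d} (hB : ω ∈ Bset D n a A T) (hav : th T ω ∈ av D {p | p ∈ a}) :
    alphaList D n ω = a ∧ sg D n ω < T ∧ ω T ∈ A ∧ ∀ t, sg D n ω < t → t < T → ω t ∉ A := by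
  obtain ⟨ω', h1, h2, h3, h4, h5, h6, h7⟩ := hB
  have := replacement hW h1 (T := T) h4.le h2 h5 (by
    intro t ht hal
    obtain ⟨u, rfl⟩ := Nat.exists_eq_add_of_le ht.le
    rw [h3]
    exact hav u ((alive_add D T u ω).1 hal).2)
  refine ⟨this.1.trans h3, by rw [this.2]; exact h4, by rw [h2 T le_rfl]; exact h6, ?_⟩
  intro t ht htT
  rw [h2 t htT.le]
  exact h7 t (this.2 ▸ ht) htT

lemma H_le {D : Set (V d)} {n m : ℕ} (hD : cube 0 (n + m) ⊆ D) {ω : ℕ → V d} (h : good ω)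
    {A : Set (V d)} (hA : lerw D ω (k1 D n ω) ∉ A) :
    hitCount A (betaList D n m ω) = 0 ∨ ∃ T, ω ∈ Bset D n (alphaList D n ω) A T ∧
      th T ω ∈ av D {p | p ∈ alphaList D n ω} ∧
      (hitCount A (betaList D n m ω) : ℝ≥0∞) ≤ NN D A (th T ω) := by
  have hW : cube 0 n ⊆ D := (cube_mono (by omega)).trans hD
  obtain ⟨k2, hk, hc, hp, hτ⟩ := beta_facts hD h
  rw [hc A]
  set F := (Finset.range (k2 - k1 D n ω + 1)).filter fun i => lerw D ω (k1 D n ω + i) ∈ A with hF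
  set K := k1 D n ω with hK
  set τ := leTime (stopAt D ω) with hτd
  rcases Finset.eq_empty_or_nonempty F with hE | hE
  · left; rw [hE]; rfl
  right
  have hmono := mono_of_run hτ
  have hFi : ∀ i ∈ F, sg D n ω < τ (K + i) ∧ alive D (τ (K + i)) ω ∧ ω (τ (K + i)) ∈ A ∧ K + i ≤ k2 := by
    intro i hi
    rw [hF, Finset.mem_filter, Finset.mem_range] at hi
    have hi0 : 0 < i := by
      rcases Nat.eq_zero_or_pos i with h0 | h0
      · subst h0; exact absurd hi.2 hA
      · exact h0
    have hle : K + i ≤ k2 := by omega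
    have hpr := hp (K + i) (by omega) hle
    have hal := alive_mono (Nat.le_succ _) (alive_of_stop hpr.1)
    refine ⟨hmono K (K + i) le_rfl (by omega) hle, hal, ?_, hle⟩
    have := hi.2
    change stopAt D ω (τ (K + i)) ∈ A at this
    rwa [stop_alive hal] at this
  have hex : ∃ t, sg D n ω < t ∧ alive D t ω ∧ ω t ∈ A := by
    obtain ⟨i, hi⟩ := hE
    obtain ⟨h1, h2, h3, _⟩ := hFi i hi
    exact ⟨_, h1, h2, h3⟩
  let T := Nat.find hex
  obtain ⟨t1, t2, t3⟩ : sg D n ω < T ∧ alive D T ω ∧ ω T ∈ A := Nat.find_spec hex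
  have tmin : ∀ t, sg D n ω < t → alive D t ω → ω t ∈ A → T ≤ t := fun t h1 h2 h3 =>
    Nat.find_min' hex ⟨h1, h2, h3⟩
  refine ⟨T, ⟨ω, h, fun _ _ => rfl, rfl, t1, t2, t3, ?_⟩, ?_, ?_⟩
  · intro t h1 h2 h3
    have := tmin t h1 (alive_mono h2.le t2) h3
    omega
  · intro j hj
    exact avoid_after hW h (by omega) ((alive_add D T j ω).2 ⟨t2, hj⟩)
  · have hTle : ∀ i ∈ F, T ≤ τ (K + i) := fun i hi => by
      obtain ⟨h1, h2, h3, _⟩ := hFi i hi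
      exact tmin _ h1 h2 h3
    have e1 : (F.card : ℝ≥0∞) = ∑ i ∈ F, X D A (τ (K + i) - T) (th T ω) := by
      rw [Finset.card_eq_sum_ones]
      push_cast
      apply Finset.sum_congr rfl
      intro i hi
      obtain ⟨h1, h2, h3, _⟩ := hFi i hi
      have hT := hTle i hi
      have e : T + (τ (K + i) - T) = τ (K + i) := by omega
      unfold X
      rw [if_pos]
      constructor
      · refine ((alive_add D T _ ω).1 ?_).2
        rw [e]; exact h2
      · change ω (T + (τ (K + i) - T)) ∈ A
        rw [e]; exact h3
    rw [e1, ← Finset.sum_image (s := F) (g := fun i => τ (K + i) - T) (f := fun u => X D A u (th T ω))]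
    · exact ENNReal.sum_le_tsum _
    · intro i hi j hj hij
      have a1 := hTle i hi
      have a2 := hTle j hj
      have b1 := (hFi i hi).2.2.2
      have b2 := (hFi j hj).2.2.2
      simp only at hij
      rcases lt_trichotomy i j with hl | hl | hl
      · have := hmono (K + i) (K + j) (by omega) (by omega) b2
        omega
      · exact hl
      · have := hmono (K + j) (K + i) (by omega) (by omega) b1
        omega

lemma H_small {D : Set (V d)} {n m : ℕ} (hD : cube 0 (n + m) ⊆ D) {ω : ℕ → V d} (h : good ω)
    (x1 : V d) (r R : ℕ) (hr : r ≤ R) :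
    hitCount (cube x1 r) (betaList D n m ω) ≤ (cube_finite (0 : V d) R).toFinset.card := by
  obtain ⟨k2, hk, hc, hp, hτ⟩ := beta_facts hD h
  rw [hc]
  have hinj := inj_of_run hp hτ
  apply Finset.card_le_card_of_injOn (fun i => lerw D ω (k1 D n ω + i) - x1)
  · intro i hi
    simp only [Finset.coe_filter, Set.mem_ofPred_eq] at hi
    simp only [Set.Finite.coe_toFinset]
    refine cube_mono hr ?_
    intro j
    have := hi.2 j
    simpa using this
  · intro i hi j hj hij
    simp only [Finset.coe_filter, Set.mem_ofPred_eq, Finset.mem_range] at hi hj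
    have hij' : lerw D ω (k1 D n ω + i) = lerw D ω (k1 D n ω + j) := sub_left_injective hij
    rcases lt_trichotomy i j with hl | hl | hl
    · exact absurd hij' (hinj _ _ (by omega) (by omega) (by omega))
    · exact hl
    · exact absurd hij'.symm (hinj _ _ (by omega) (by omega) (by omega))

lemma bdry_coord {x : V d} {n : ℕ} (h : x ∈ innerBdry (cube 0 n)) : ∃ i, |x i| = (n : ℤ) := by
  obtain ⟨h1, y, hxy, hy⟩ := h
  by_contra! hc
  apply hy
  obtain ⟨e, rfl⟩ := (adj_iff _ _).1 hxy
  rw [mem_cube0] at h1 ⊢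
  intro j
  have h2 := h1 j
  have h3 : |x j| < n := lt_of_le_of_ne (abs_le.2 h2) (hc j)
  rw [abs_lt] at h3
  have h4 : -1 ≤ stp e j ∧ stp e j ≤ 1 := by
    obtain ⟨i, b⟩ := e
    by_cases hij : j = i
    · subst hij; cases b <;> simp [stp, ee]
    · cases b <;> simp [stp, ee, hij]
  rw [Pi.add_apply]
  omega

lemma geom {x0 : V d} {n m : ℕ} (hm : 4 ≤ m) (h : x0 ∈ innerBdry (cube 0 n)) :
    ∀ y ∈ cube (x1pt x0 n m) (m / 2 - 1), y ∉ cube (0 : V d) n ∧ y ∈ cube (0 : V d) (n + m) := by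
  intro y hy
  have hex := bdry_coord h
  have hx0 := mem_cube0.1 h.1
  have hspec := Classical.choose_spec hex
  set i0 := Classical.choose hex with hi0
  have e : ∀ j, x1pt x0 n m j = x0 j + ((m / 2 : ℕ) : ℤ) * (if j = i0 then (if 0 ≤ x0 i0 then 1 else -1) else 0) := by
    intro j
    simp only [x1pt, Pi.add_apply, Pi.smul_apply, smul_eq_mul, faceDir, dif_pos hex]
    rfl
  have hyj : ∀ j, |y j - x1pt x0 n m j| ≤ ((m / 2 - 1 : ℕ) : ℤ) := hy
  constructor
  · intro hc
    have hc := mem_cube0.1 hc i0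
    have h1 := hyj i0
    rw [e i0, if_pos rfl] at h1
    split_ifs at h1 with hs
    · rw [abs_of_nonneg hs] at hspec
      rw [abs_le] at h1; omega
    · rw [abs_of_neg (not_le.1 hs)] at hspec
      rw [abs_le] at h1; omega
  · rw [mem_cube0]
    intro j
    have h1 := hyj j
    have h2 := hx0 j
    rw [e j, abs_le] at h1
    split_ifs at h1 <;> omega

lemma cond_le {μ : Measure (ℕ → V d)} [IsProbabilityMeasure μ] {s M : Set (ℕ → V d)}
    (hs : s =ᵐ[μ] M) (h0 : μ s ≠ 0) (f : (ℕ → V d) → ℝ≥0∞) (C : ℝ≥0∞)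
    (h : ∫⁻ ω in M, f ω ∂μ ≤ C * μ s) : ∫⁻ ω, f ω ∂(ProbabilityTheory.cond μ s) ≤ C := by
  unfold ProbabilityTheory.cond
  rw [lintegral_smul_measure, Measure.restrict_congr_set hs, smul_eq_mul]
  calc (μ s)⁻¹ * ∫⁻ ω in M, f ω ∂μ ≤ (μ s)⁻¹ * (C * μ s) := by gcongr
    _ = C * (μ s * (μ s)⁻¹) := by ring
    _ = C := by rw [ENNReal.mul_inv_cancel h0 (measure_ne_top μ s), mul_one]

lemma sum_bound (hd : 3 ≤ d) {μ : Measure (ℕ → V d)} (h : IsSRWLaw μ 0) {D : Set (V d)} {n : ℕ}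
    (hW : cube 0 n ⊆ D) (a : List (V d)) (A : Set (V d)) (G : (ℕ → V d) → ℝ≥0∞) (hG : Measurable G)
    (C : ℝ≥0∞) (hC : ∀ z ∈ A, ∫⁻ ω, G ω ∂(nu μ z) ≤ C * nu μ z (av D {p | p ∈ a})) :
    ∫⁻ ω, ∑' T, (Bset D n a A T).indicator 1 ω * G (th T ω) ∂μ ≤ C * μ {ω | alphaList D n ω = a} := by
  set E := av D {p | p ∈ a} with hE
  have hEm : MeasurableSet E := measurableSet_av _ _
  have hBm : ∀ T, MeasurableSet (Bset D n a A T) := fun T => (B_adapted D n a A T).measurableSet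
  have hBa : ∀ T, Adapted T (fun ω => (Bset D n a A T).indicator (1 : (ℕ → V d) → ℝ≥0∞) ω) := by
    intro T ω ω' hh
    have := B_adapted D n a A T ω ω' hh
    simp only [eq_iff_iff] at this
    simp only [Set.indicator, this, Pi.one_apply]
  have hms : ∀ T, AEMeasurable (fun ω => (Bset D n a A T).indicator 1 ω * G (th T ω)) μ := fun T =>
    ((measurable_one.indicator (hBm T)).mul (hG.comp (measurable_th T))).aemeasurable
  rw [lintegral_tsum hms]
  have step : ∀ T, ∫⁻ ω, (Bset D n a A T).indicator 1 ω * G (th T ω) ∂μ ≤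
      C * μ (Bset D n a A T ∩ th T ⁻¹' E) := by
    intro T
    rw [markov0 hd h T _ G (hBa T) hG]
    have e : μ (Bset D n a A T ∩ th T ⁻¹' E) =
        ∫⁻ ω, (Bset D n a A T).indicator 1 ω * E.indicator 1 (th T ω) ∂μ := by
      rw [← lintegral_indicator_one ((hBm T).inter (measurable_th T hEm))]
      congr 1
      funext ω
      by_cases h1 : ω ∈ Bset D n a A T <;> by_cases h2 : th T ω ∈ E <;> simp [h1, h2]
    rw [e, markov0 hd h T _ (E.indicator 1) (hBa T) (measurable_one.indicator hEm)]
    simp only [lintegral_indicator_one hEm]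
    calc _ ≤ ∫⁻ ω, C * ((Bset D n a A T).indicator 1 ω * nu μ (ω T) E) ∂μ := by
          apply lintegral_mono
          intro ω
          dsimp only
          by_cases h1 : ω ∈ Bset D n a A T
          · simp only [Set.indicator_of_mem h1, Pi.one_apply, one_mul]
            apply hC
            obtain ⟨ω', _, h2, _, _, _, h6, _⟩ := h1
            rw [h2 T le_rfl]; exact h6
          · simp [h1]
      _ = _ := by
          rw [lintegral_const_mul]
          refine (measurable_one.indicator (hBm T)).mul ?_
          exact (measurable_of_countable (fun z : V d => nu μ z E)).comp (measurable_pi_apply T)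
  calc _ ≤ ∑' T, C * μ (Bset D n a A T ∩ th T ⁻¹' E) := ENNReal.tsum_le_tsum step
    _ = C * μ (⋃ T, (Bset D n a A T ∩ th T ⁻¹' E)) := by
        rw [ENNReal.tsum_mul_left, measure_iUnion]
        · intro T T' hT
          rw [Function.onFun, Set.disjoint_left]
          rintro ω ⟨h1, h2⟩ ⟨h3, h4⟩
          obtain ⟨_, b1, b2, b3⟩ := B_repl hW h1 h2
          obtain ⟨_, c1, c2, c3⟩ := B_repl hW h3 h4
          rcases lt_or_gt_of_ne hT with hl | hl
          · exact c3 T b1 hl b2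
          · exact b3 T' c1 hl c2
        · exact fun T => (hBm T).inter (measurable_th T hEm)
    _ ≤ _ := by
        gcongr
        refine Set.iUnion_subset fun T => ?_
        rintro ω ⟨h1, h2⟩
        exact (B_repl hW h1 h2).1

lemma moment_gen {μ : Measure (ℕ → V d)} (h : IsSRWLaw μ 0) (hd : 3 ≤ d) {D : Set (V d)} {n m : ℕ}
    (hD : cube 0 (n + m) ⊆ D) (a : List (V d)) (A : Set (V d)) (hA : endPt a ∉ A) (k : ℕ) (hk : k ≠ 0)
    (C : ℝ≥0∞) (h0 : μ {ω | alphaList D n ω = a} ≠ 0)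
    (hC : ∀ z ∈ A, ∫⁻ ω, NN D A ω ^ k * (av D {p | p ∈ a}).indicator 1 ω ∂(nu μ z) ≤
      C * nu μ z (av D {p | p ∈ a})) :
    ∫⁻ ω, (hitCount A (betaList D n m ω) : ℝ≥0∞) ^ k
      ∂(ProbabilityTheory.cond μ {ω | alphaList D n ω = a}) ≤ C := by
  have := h.1
  have hW : cube 0 n ⊆ D := (cube_mono (by omega)).trans hD
  have hg := ae_good hd h
  have hs : {ω | alphaList D n ω = a} =ᵐ[μ] Mset D n a := by
    filter_upwards [hg] with ω hω
    exact propext (M_iff hW a hω)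
  refine cond_le hs h0 _ _ (le_trans ?_ (sum_bound hd h hW a A _
    (((measurable_NN D A).pow_const k).mul (measurable_one.indicator (measurableSet_av D {p | p ∈ a}))) C hC))
  refine le_trans ?_ (setLIntegral_le_lintegral (Mset D n a) _)
  apply lintegral_mono_ae
  filter_upwards [ae_restrict_of_ae hg, ae_restrict_mem (measurable_M D n a)] with ω h1 h2
  have ha := (M_iff hW a h1).2 h2
  have hA' : lerw D ω (k1 D n ω) ∉ A := by rw [← endPt_alpha, ha]; exact hA
  rcases H_le (m := m) hD h1 hA' with hz | ⟨T, hT, hav, hle⟩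
  · rw [hz]; simp [hk]
  · rw [ha] at hT hav
    refine le_trans ?_ (ENNReal.le_tsum T)
    simp only [Set.indicator_of_mem hT, Pi.mul_apply, Set.indicator_of_mem hav, Pi.one_apply, one_mul, mul_one]
    gcongr

lemma moment_small {μ : Measure (ℕ → V d)} (h : IsSRWLaw μ 0) (hd : 3 ≤ d) {D : Set (V d)} {n m : ℕ}
    (hD : cube 0 (n + m) ⊆ D) (a : List (V d)) (x1 : V d) (r R : ℕ) (hr : r ≤ R) (k : ℕ)
    (h0 : μ {ω | alphaList D n ω = a} ≠ 0) :
    ∫⁻ ω, (hitCount (cube x1 r) (betaList D n m ω) : ℝ≥0∞) ^ k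
      ∂(ProbabilityTheory.cond μ {ω | alphaList D n ω = a}) ≤
      ((cube_finite (0 : V d) R).toFinset.card : ℝ≥0∞) ^ k := by
  have := h.1
  have hW : cube 0 n ⊆ D := (cube_mono (by omega)).trans hD
  have hg := ae_good hd h
  have hs : {ω | alphaList D n ω = a} =ᵐ[μ] Mset D n a := by
    filter_upwards [hg] with ω hω
    exact propext (M_iff hW a hω)
  refine cond_le hs h0 _ _ ?_
  rw [measure_congr hs]
  calc _ ≤ ∫⁻ ω in Mset D n a, ((cube_finite (0 : V d) R).toFinset.card : ℝ≥0∞) ^ k ∂μ := by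
        apply lintegral_mono_ae
        filter_upwards [ae_restrict_of_ae hg] with ω h1
        gcongr
        exact H_small hD h1 x1 r R hr
    _ = _ := by rw [setLIntegral_const]

lemma final_bound (hd : 3 ≤ d) : ∃ c₁ : ℝ, 0 < c₁ ∧
      ∀ (N n m : ℕ) (D : Set (V d)),
        cube 0 N ⊆ D → 16 ≤ n → n < n + m → n + m ≤ N → m ≤ n / 8 →
        ∀ μ : Measure (ℕ → V d), IsSRWLaw μ 0 →
        ∀ a : List (V d), μ { ω | alphaList D n ω = a } ≠ 0 →
          (∫⁻ ω, (hitCount (boxA (endPt a) n m) (betaList D n m ω) : ℝ≥0∞)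
              ∂(ProbabilityTheory.cond μ { ω | alphaList D n ω = a })
            ≤ ENNReal.ofReal (c₁ * (m : ℝ) ^ 2)) ∧
          (∫⁻ ω, (hitCount (boxA (endPt a) n m) (betaList D n m ω) : ℝ≥0∞) ^ 2
              ∂(ProbabilityTheory.cond μ { ω | alphaList D n ω = a })
            ≤ ENNReal.ofReal (c₁ * (m : ℝ) ^ 4)) := by
  obtain ⟨K, hK, hmom⟩ := moments (d := d) hd
  set K0 : ℕ := (cube_finite (0 : V d) (200 * d)).toFinset.card with hK0
  refine ⟨K + K0 + (K0 : ℝ) ^ 2, by positivity, ?_⟩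
  intro N n m D hDN hn hm hN hmn μ h a h0
  have := h.1
  have hD : cube 0 (n + m) ⊆ D := (cube_mono hN).trans hDN
  have hW : cube 0 n ⊆ D := (cube_mono (by omega)).trans hD
  have hm1 : (1 : ℝ) ≤ m := by exact_mod_cast (by omega : 1 ≤ m)
  have hK0' : (0 : ℝ) ≤ K0 := by positivity
  have p2 : (1 : ℝ) ≤ (m : ℝ) ^ 2 := one_le_pow₀ hm1
  have p4 : (1 : ℝ) ≤ (m : ℝ) ^ 4 := one_le_pow₀ hm1
  unfold boxA
  by_cases hlarge : 200 * d ≤ m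
  · have hm4 : 4 ≤ m := by omega
    obtain ⟨ω0, hα, hgood⟩ : ∃ ω, alphaList D n ω = a ∧ good ω := by
      by_contra hc
      push Not at hc
      apply h0
      have := ae_good hd h
      rw [ae_iff] at this
      exact measure_mono_null (fun ω hω => hc ω hω) this
    have hx0 : endPt a ∈ innerBdry (cube 0 n) := by
      rw [← hα, endPt_alpha]; exact (alpha_facts hW hgood).1
    have hcub : ∀ p ∈ a, p ∈ cube (0 : V d) n := by
      intro p hp
      rw [← hα] at hp
      obtain ⟨i, hi, rfl⟩ := mem_alpha.1 hp
      exact ((alpha_facts hW hgood).2.2.1 i hi).2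
    have hg := geom hm4 hx0
    have hsub : cube (x1pt (endPt a) n m) (m / 2 - 1) ⊆ D \ {p | p ∈ a} :=
      fun y hy => ⟨hD (hg y hy).2, fun hya => (hg y hy).1 (hcub y hya)⟩
    have hA : endPt a ∉ cube (x1pt (endPt a) n m) (m / 4) := by
      intro hc
      exact (hg _ (cube_mono (by omega) hc)).1 hx0.1
    have mm := hmom D {p | p ∈ a} (x1pt (endPt a) n m) m hlarge hsub μ h
    constructor
    · have := moment_gen (m := m) h hd hD a _ hA 1 one_ne_zero _ h0 (by simpa only [pow_one] using fun z hz => (mm z hz).1)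
      simp only [pow_one] at this
      refine this.trans (ENNReal.ofReal_le_ofReal ?_)
      gcongr
      nlinarith [sq_nonneg (K0 : ℝ)]
    · have := moment_gen (m := m) h hd hD a _ hA 2 two_ne_zero _ h0 (fun z hz => (mm z hz).2)
      refine this.trans (ENNReal.ofReal_le_ofReal ?_)
      gcongr
      nlinarith [sq_nonneg (K0 : ℝ)]
  · have ms := fun k => moment_small (m := m) h hd hD a (x1pt (endPt a) n m) (m / 4) (200 * d) (by omega) k h0
    constructor
    · have := ms 1
      simp only [pow_one] at this
      refine this.trans ?_
      rw [← hK0, ← ENNReal.ofReal_natCast]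
      apply ENNReal.ofReal_le_ofReal
      nlinarith [sq_nonneg (K0 : ℝ)]
    · refine (ms 2).trans ?_
      rw [← hK0, ← ENNReal.ofReal_natCast, ← ENNReal.ofReal_pow hK0']
      apply ENNReal.ofReal_le_ofReal
      nlinarith [sq_nonneg (K0 : ℝ)]

/-- Lemma 3.3.  Let `d ≥ 3`, and adopt the shell setup (`Q_N ⊆ D`, `16 ≤ n < n+m ≤ N`,
`m ≤ n/8`, `L` the loop erasure of SRW from `0` stopped at its first exit from `D`,
`α` its initial segment up to the first hit of `∂ᵢQ_n` with endpoint `x₀`, `β` the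
segment from `x₀` to the first hit of `∂ᵢQ(x₀,m)`, and `A = Q(x₀ + (m/2)e₁, m/4)`
suitably rotated).  There is `c₁ = c₁(d)` such that for every realization of `α`:
`E( H_A(β) | α ) ≤ c₁ m²` and `E( H_A(β)² | α ) ≤ c₁ m⁴`. -/
theorem HA_beta_moment_upper_bounds :
    ∀ d : ℕ, 3 ≤ d → ∃ c₁ : ℝ, 0 < c₁ ∧
      ∀ (N n m : ℕ) (D : Set (V d)),
        cube 0 N ⊆ D → 16 ≤ n → n < n + m → n + m ≤ N → m ≤ n / 8 →
        ∀ μ : Measure (ℕ → V d), IsSRWLaw μ 0 →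
        ∀ a : List (V d), μ { ω | alphaList D n ω = a } ≠ 0 →
          (∫⁻ ω, (hitCount (boxA (endPt a) n m) (betaList D n m ω) : ℝ≥0∞)
              ∂(ProbabilityTheory.cond μ { ω | alphaList D n ω = a })
            ≤ ENNReal.ofReal (c₁ * (m : ℝ) ^ 2)) ∧
          (∫⁻ ω, (hitCount (boxA (endPt a) n m) (betaList D n m ω) : ℝ≥0∞) ^ 2
              ∂(ProbabilityTheory.cond μ { ω | alphaList D n ω = a })
            ≤ ENNReal.ofReal (c₁ * (m : ℝ) ^ 4)) := by
  intro d hd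
  exact final_bound hd

end USFPaper
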